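/- arXiv:2406.14911 — 2 statements merged into one kernel-verified Lean document; each statement's English description precedes it below -/
import Mathlib

section
/- The regular closure of the deterministic context-free languages is contained in the class of parsing expression languages: every language in the smallest class containing all DCFLs and closed under union, concatenation, and Kleene star is a PEL. -/
/-! ### Parsing expression grammars -/

/-- Parsing expressions over nonterminals `N` and input alphabet `A`:
`ε`, terminals, nonterminals, sequence, prioritized choice, not-predicate. -/
inductive PExp (N A : Type) : Type where
  | eps : PExp N A
  | term : A → PExp N A
  | nt : N → PExp N A
  | seq : PExp N A → PExp N A → PExp N A
  | choice : PExp N A → PExp N A → PExp N A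
  | not : PExp N A → PExp N A

/-- A parsing expression grammar: one rule per nonterminal, and an axiom. -/
structure PEG (N A : Type) : Type where
  rule : N → PExp N A
  start : N

/-- Big-step relational semantics of the PEG parsing function `R`:
`Parses G e w r` means `R(e, w) = r`, where `r = none` encodes the failure `F`
and `r = some s` means that `e` consumed a prefix of `w` leaving the suffix `s`.
`R(e, w)` is defined iff `∃ r, Parses G e w r`. -/
inductive Parses {N A : Type} (G : PEG N A) : PExp N A → List A → Option (List A) → Prop where
  | eps (w : List A) : Parses G .eps w (some w)
  | term_ok (a : A) (s : List A) : Parses G (.term a) (a :: s) (some s)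
  | term_mismatch {a b : A} (s : List A) (h : a ≠ b) : Parses G (.term a) (b :: s) none
  | term_nil (a : A) : Parses G (.term a) [] none
  | nt {B : N} {w : List A} {r : Option (List A)} :
      Parses G (G.rule B) w r → Parses G (.nt B) w r
  | seq_ok {e₁ e₂ : PExp N A} {w w' : List A} {r : Option (List A)} :
      Parses G e₁ w (some w') → Parses G e₂ w' r → Parses G (.seq e₁ e₂) w r
  | seq_fail {e₁ e₂ : PExp N A} {w : List A} :
      Parses G e₁ w none → Parses G (.seq e₁ e₂) w none
  | choice_fst {e₁ e₂ : PExp N A} {w w' : List A} :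
      Parses G e₁ w (some w') → Parses G (.choice e₁ e₂) w (some w')
  | choice_snd {e₁ e₂ : PExp N A} {w : List A} {r : Option (List A)} :
      Parses G e₁ w none → Parses G e₂ w r → Parses G (.choice e₁ e₂) w r
  | not_succ {e : PExp N A} {w : List A} :
      Parses G e w none → Parses G (.not e) w (some w)
  | not_fail {e : PExp N A} {w w' : List A} :
      Parses G e w (some w') → Parses G (.not e) w none

/-- The language generated by a PEG: `L(G) = {w | R(S, w) = ε}`. -/
def PEG.Lang {N A : Type} (G : PEG N A) : Set (List A) :=
  {w | Parses G (.nt G.start) w (some [])}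

/-- A PEG is complete if `R(S, w)` is defined for every input `w`. -/
def PEG.Complete {N A : Type} (G : PEG N A) : Prop :=
  ∀ w : List A, ∃ r, Parses G (.nt G.start) w r

/-- Conservative test whether an expression could succeed without consuming input. -/
def PExp.maybeEmpty {N A : Type} : PExp N A → Bool
  | .eps => true
  | .term _ => false
  | .nt _ => true
  | .seq e₁ e₂ => e₁.maybeEmpty && e₂.maybeEmpty
  | .choice e₁ e₂ => e₁.maybeEmpty || e₂.maybeEmpty
  | .not _ => true

/-- The nonterminals that an expression can invoke without first consuming input. -/
def PExp.leftNts {N A : Type} : PExp N A → Set N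
  | .eps => ∅
  | .term _ => ∅
  | .nt B => {B}
  | .seq e₁ e₂ => e₁.leftNts ∪ (if e₁.maybeEmpty then e₂.leftNts else ∅)
  | .choice e₁ e₂ => e₁.leftNts ∪ e₂.leftNts
  | .not e => e.leftNts

/-- A PEG is well-formed if it has no (directly or mutually) left-recursive rules:
no nonterminal can reach an invocation of itself without consuming input. -/
def PEG.WellFormed {N A : Type} (G : PEG N A) : Prop :=
  ∀ B : N, ¬ Relation.TransGen (fun X Y : N => Y ∈ (G.rule X).leftNts) B B

/-- A language is a parsing expression language (PEL) if it is generated by some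
well-formed PEG with a finite set of nonterminals. -/
def IsPEL {A : Type} (L : Set (List A)) : Prop :=
  ∃ (N : Type) (_ : Finite N) (G : PEG N A), G.WellFormed ∧ G.Lang = L

/-! ### Standard deterministic pushdown automata -/

/-- A standard one-way deterministic pushdown automaton accepting by final state,
with reading transitions `transA` and ε-transitions `transE`; determinism requires
that no ε-move is available whenever a reading move is. -/
structure DPDA (Q A Γ : Type) : Type where
  transA : Q → A → Γ → Option (Q × List Γ)
  transE : Q → Γ → Option (Q × List Γ)
  det : ∀ q Z, transE q Z ≠ none → ∀ a, transA q a Z = none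
  init : Q
  Z0 : Γ
  final : Q → Bool

/-- One move of a DPDA on configurations `(state, stack, remaining input)`. -/
inductive DPDA.Step {Q A Γ : Type} (M : DPDA Q A Γ) :
    Q × List Γ × List A → Q × List Γ × List A → Prop where
  | readA {q : Q} {a : A} {Z : Γ} {γ : List Γ} {u : List A} {p : Q} {β : List Γ} :
      M.transA q a Z = some (p, β) → DPDA.Step M (q, Z :: γ, a :: u) (p, β ++ γ, u)
  | readE {q : Q} {Z : Γ} {γ : List Γ} {u : List A} {p : Q} {β : List Γ} :
      M.transE q Z = some (p, β) → DPDA.Step M (q, Z :: γ, u) (p, β ++ γ, u)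

/-- The language of a DPDA: words after whose consumption a final state is reached. -/
def DPDA.Lang {Q A Γ : Type} (M : DPDA Q A Γ) : Set (List A) :=
  {w | ∃ (p : Q) (γ : List Γ),
    Relation.ReflTransGen (DPDA.Step M) (M.init, [M.Z0], w) (p, γ, []) ∧ M.final p = true}

/-- A language is a DCFL if it is recognized by some DPDA with finitely many
states and stack symbols. -/
def IsDCFL {A : Type} (L : Set (List A)) : Prop :=
  ∃ (Q Γ : Type) (_ : Finite Q) (_ : Finite Γ) (M : DPDA Q A Γ), M.Lang = L

/-- Concatenation of languages: `XY = {xy | x ∈ X, y ∈ Y}`. -/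
def concatL {A : Type} (X Y : Set (List A)) : Set (List A) :=
  {w | ∃ x ∈ X, ∃ y ∈ Y, w = x ++ y}

/-- Kleene star of a language: all concatenations of finitely many words of `X`. -/
def kstarL {A : Type} (X : Set (List A)) : Set (List A) :=
  {w | ∃ l : List (List A), (∀ u ∈ l, u ∈ X) ∧ w = l.flatten}

/-- The regular closure of the DCFLs: the smallest class of languages containing
all DCFLs and closed under union, concatenation and Kleene star. -/
inductive RegClosureDCFL {A : Type} : Set (List A) → Prop where
  | dcfl {L : Set (List A)} : IsDCFL L → RegClosureDCFL L
  | union {L₁ L₂ : Set (List A)} :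
      RegClosureDCFL L₁ → RegClosureDCFL L₂ → RegClosureDCFL (L₁ ∪ L₂)
  | concat {L₁ L₂ : Set (List A)} :
      RegClosureDCFL L₁ → RegClosureDCFL L₂ → RegClosureDCFL (concatL L₁ L₂)
  | star {L : Set (List A)} : RegClosureDCFL L → RegClosureDCFL (kstarL L)

/-! ### Part 1: normal form of the regular closure -/

/-- `w` factors as a nonempty word of `e.1` and a word of `e.2` for a pair `e` of the list. -/
def Fac {A : Type} (es : List (Set (List A) × Set (List A))) (w : List A) : Prop :=
  ∃ e ∈ es, ∃ x ∈ e.1, ∃ y ∈ e.2, x ≠ [] ∧ w = x ++ y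

/-- A finite system of languages closed under factoring out DCFL prefixes. -/
def Good {A : Type} (F : Set (Set (List A))) : Prop :=
  F.Finite ∧ ∀ L ∈ F, ∃ es : List (Set (List A) × Set (List A)),
    (∀ e ∈ es, IsDCFL e.1 ∧ e.2 ∈ F) ∧ ∀ w, w ≠ [] → (w ∈ L ↔ Fac es w)

theorem fac_append {A : Type} (es fs : List (Set (List A) × Set (List A))) (w : List A) :
    Fac (es ++ fs) w ↔ Fac es w ∨ Fac fs w := by
  unfold Fac
  constructor
  · rintro ⟨e, he, h⟩
    rcases List.mem_append.1 he with he | he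
    · exact Or.inl ⟨e, he, h⟩
    · exact Or.inr ⟨e, he, h⟩
  · rintro (⟨e, he, h⟩ | ⟨e, he, h⟩)
    · exact ⟨e, List.mem_append.2 (Or.inl he), h⟩
    · exact ⟨e, List.mem_append.2 (Or.inr he), h⟩

theorem fac_map {A : Type} (es : List (Set (List A) × Set (List A))) (Y : Set (List A))
    (w : List A) :
    Fac (es.map fun e => (e.1, concatL e.2 Y)) w ↔ ∃ x y, Fac es x ∧ y ∈ Y ∧ w = x ++ y := by
  constructor
  · rintro ⟨e, he, x, hx, y, hy, hne, rfl⟩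
    obtain ⟨e, hm, rfl⟩ := List.mem_map.1 he
    obtain ⟨y, hy, z, hz, rfl⟩ := hy
    exact ⟨x ++ y, z, ⟨e, hm, x, hx, y, hy, hne, rfl⟩, hz, by simp⟩
  · rintro ⟨_, z, ⟨e, he, x, hx, y, hy, hne, rfl⟩, hz, rfl⟩
    exact ⟨_, List.mem_map.2 ⟨e, he, rfl⟩, x, hx, y ++ z, ⟨y, hy, z, hz, rfl⟩, hne, by simp⟩

theorem Fac.ne_nil {A : Type} {es : List (Set (List A) × Set (List A))} {w : List A}
    (h : Fac es w) : w ≠ [] := by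
  obtain ⟨e, he, x, hx, y, hy, hne, rfl⟩ := h
  simp [hne]

open Classical in
theorem fac_concat {A : Type} {X Y : Set (List A)} {es fs : List (Set (List A) × Set (List A))}
    (hX : ∀ w, w ≠ [] → (w ∈ X ↔ Fac es w)) (hY : ∀ w, w ≠ [] → (w ∈ Y ↔ Fac fs w))
    (w : List A) (hw : w ≠ []) :
    w ∈ concatL X Y ↔
      Fac ((es.map fun e => (e.1, concatL e.2 Y)) ++ if [] ∈ X then fs else []) w := by
  rw [fac_append, fac_map]
  constructor
  · rintro ⟨x, hx, y, hy, rfl⟩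
    by_cases h : x = []
    · subst h
      right
      rw [if_pos hx]
      exact (hY _ hw).1 hy
    · left
      exact ⟨x, y, (hX x h).1 hx, hy, rfl⟩
  · rintro (⟨x, y, hx, hy, rfl⟩ | h)
    · exact ⟨x, (hX x hx.ne_nil).2 hx, y, hy, rfl⟩
    · split_ifs at h with h0
      · exact ⟨[], h0, w, (hY w hw).2 h, rfl⟩
      · obtain ⟨e, he, _⟩ := h
        simp at he

theorem fac_star {A : Type} {X : Set (List A)} {es : List (Set (List A) × Set (List A))}
    (hX : ∀ w, w ≠ [] → (w ∈ X ↔ Fac es w)) (w : List A) (hw : w ≠ []) :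
    w ∈ kstarL X ↔ Fac (es.map fun e => (e.1, concatL e.2 (kstarL X))) w := by
  rw [fac_map]
  constructor
  · rintro ⟨l, hl, rfl⟩
    induction l with
    | nil => simp at hw
    | cons x l ih =>
      by_cases h : x = []
      · subst h
        simp only [List.flatten_cons, List.nil_append] at hw ⊢
        exact ih (fun u hu => hl u (List.mem_cons_of_mem _ hu)) hw
      · exact ⟨x, l.flatten, (hX x h).1 (hl x (by simp)),
          ⟨l, fun u hu => hl u (List.mem_cons_of_mem _ hu), rfl⟩, by simp⟩
  · rintro ⟨x, y, hx, ⟨l, hl, rfl⟩, rfl⟩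
    refine ⟨x :: l, ?_, by simp⟩
    intro u hu
    rcases List.mem_cons.1 hu with rfl | hu
    · exact (hX _ hx.ne_nil).2 hx
    · exact hl u hu

theorem exists_good {A : Type} {L : Set (List A)} (hL : RegClosureDCFL L) :
    ∃ F, Good F ∧ L ∈ F := by
  classical
  induction hL with
  | @dcfl L h =>
    refine ⟨{L, {[]}}, ⟨by simp, ?_⟩, by simp⟩
    rintro K (rfl | rfl)
    · refine ⟨[(K, {[]})], by simp [h], ?_⟩
      intro w hw
      simp [Fac, hw]
    · exact ⟨[], by simp, fun w hw => by simp [Fac, hw]⟩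
  | @union L₁ L₂ _ _ ih₁ ih₂ =>
    obtain ⟨F₁, ⟨f₁, g₁⟩, m₁⟩ := ih₁
    obtain ⟨F₂, ⟨f₂, g₂⟩, m₂⟩ := ih₂
    refine ⟨(F₁ ∪ F₂) ∪ {L₁ ∪ L₂}, ⟨(f₁.union f₂).union (Set.finite_singleton _), ?_⟩, by simp⟩
    rintro K ((hK | hK) | rfl)
    · obtain ⟨es, h1, h2⟩ := g₁ K hK
      exact ⟨es, fun e he => ⟨(h1 e he).1, Or.inl (Or.inl (h1 e he).2)⟩, h2⟩
    · obtain ⟨es, h1, h2⟩ := g₂ K hK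
      exact ⟨es, fun e he => ⟨(h1 e he).1, Or.inl (Or.inr (h1 e he).2)⟩, h2⟩
    · obtain ⟨es, h1, h2⟩ := g₁ L₁ m₁
      obtain ⟨fs, h3, h4⟩ := g₂ L₂ m₂
      refine ⟨es ++ fs, ?_, ?_⟩
      · intro e he
        rcases List.mem_append.1 he with he | he
        · exact ⟨(h1 e he).1, Or.inl (Or.inl (h1 e he).2)⟩
        · exact ⟨(h3 e he).1, Or.inl (Or.inr (h3 e he).2)⟩
      · intro w hw
        rw [fac_append, ← h2 w hw, ← h4 w hw]
        rfl
  | @concat L₁ L₂ _ _ ih₁ ih₂ =>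
    obtain ⟨F₁, ⟨f₁, g₁⟩, m₁⟩ := ih₁
    obtain ⟨F₂, ⟨f₂, g₂⟩, m₂⟩ := ih₂
    refine ⟨(Set.image (fun X => concatL X L₂) F₁) ∪ F₂, ⟨(f₁.image _).union f₂, ?_⟩,
      Or.inl ⟨L₁, m₁, rfl⟩⟩
    obtain ⟨fs, h3, h4⟩ := g₂ L₂ m₂
    rintro K (⟨X, hX, rfl⟩ | hK)
    · obtain ⟨es, h1, h2⟩ := g₁ X hX
      refine ⟨_, ?_, fac_concat h2 h4⟩
      intro e he
      rcases List.mem_append.1 he with he | he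
      · obtain ⟨e, hm, rfl⟩ := List.mem_map.1 he
        exact ⟨(h1 e hm).1, Or.inl ⟨e.2, (h1 e hm).2, rfl⟩⟩
      · split_ifs at he
        · exact ⟨(h3 e he).1, Or.inr (h3 e he).2⟩
        · simp at he
    · obtain ⟨es, h1, h2⟩ := g₂ K hK
      exact ⟨es, fun e he => ⟨(h1 e he).1, Or.inr (h1 e he).2⟩, h2⟩
  | @star L _ ih =>
    obtain ⟨F, ⟨f, g⟩, m⟩ := ih
    refine ⟨(Set.image (fun X => concatL X (kstarL L)) F) ∪ {kstarL L},
      ⟨(f.image _).union (Set.finite_singleton _), ?_⟩, Or.inr rfl⟩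
    obtain ⟨fs, h3, h4⟩ := g L m
    rintro K (⟨X, hX, rfl⟩ | rfl)
    · obtain ⟨es, h1, h2⟩ := g X hX
      refine ⟨_, ?_, fac_concat h2 (fac_star h4)⟩
      intro e he
      rcases List.mem_append.1 he with he | he
      · obtain ⟨e, hm, rfl⟩ := List.mem_map.1 he
        exact ⟨(h1 e hm).1, Or.inl ⟨e.2, (h1 e hm).2, rfl⟩⟩
      · split_ifs at he
        · obtain ⟨e, hm, rfl⟩ := List.mem_map.1 he
          exact ⟨(h3 e hm).1, Or.inl ⟨e.2, (h3 e hm).2, rfl⟩⟩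
        · simp at he
    · refine ⟨_, ?_, fac_star h4⟩
      intro e he
      obtain ⟨e, hm, rfl⟩ := List.mem_map.1 he
      exact ⟨(h3 e hm).1, Or.inl ⟨e.2, (h3 e hm).2, rfl⟩⟩

/-! ### Part 2: generic facts on PEGs -/

theorem parses_length {N A : Type} {G : PEG N A} {e : PExp N A} {w : List A}
    {r : Option (List A)} (h : Parses G e w r) :
    ∀ v, r = some v → v.length ≤ w.length ∧ (e.maybeEmpty = false → v.length < w.length) := by
  induction h with
  | eps w => rintro v ⟨⟩; simp [PExp.maybeEmpty]
  | term_ok a s => rintro v ⟨⟩; simp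
  | term_mismatch s h => rintro v ⟨⟩
  | term_nil a => rintro v ⟨⟩
  | nt _ ih => intro v hv; exact ⟨(ih v hv).1, by simp [PExp.maybeEmpty]⟩
  | seq_ok _ _ ih1 ih2 =>
    intro v hv
    have a := ih1 _ rfl
    have b := ih2 _ hv
    refine ⟨by omega, ?_⟩
    intro h
    simp only [PExp.maybeEmpty, Bool.and_eq_false_iff] at h
    rcases h with h | h
    · have := a.2 h; omega
    · have := b.2 h; omega
  | seq_fail _ _ => rintro v ⟨⟩
  | choice_fst _ ih =>
    intro v hv
    have a := ih v hv
    refine ⟨a.1, fun h => ?_⟩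
    simp only [PExp.maybeEmpty, Bool.or_eq_false_iff] at h
    exact a.2 h.1
  | choice_snd _ _ _ ih =>
    intro v hv
    have a := ih v hv
    refine ⟨a.1, fun h => ?_⟩
    simp only [PExp.maybeEmpty, Bool.or_eq_false_iff] at h
    exact a.2 h.2
  | not_succ _ _ => rintro v ⟨⟩; simp [PExp.maybeEmpty]
  | not_fail _ _ => rintro v ⟨⟩

/-- A PEG whose left-reachability relation decreases a rank is total. -/
theorem parses_total {N A : Type} (G : PEG N A) (rank : N → ℕ)
    (hr : ∀ X Y, Y ∈ (G.rule X).leftNts → rank Y < rank X) (e : PExp N A) (w : List A) :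
    ∃ r, Parses G e w r := by
  have bdd : ∀ e : PExp N A, ∃ k, ∀ Y ∈ e.leftNts, rank Y < k := by
    intro e
    induction e with
    | eps => exact ⟨0, by simp [PExp.leftNts]⟩
    | term a => exact ⟨0, by simp [PExp.leftNts]⟩
    | nt B => exact ⟨rank B + 1, by simp [PExp.leftNts]⟩
    | seq e₁ e₂ h1 h2 =>
      obtain ⟨k1, h1⟩ := h1
      obtain ⟨k2, h2⟩ := h2
      refine ⟨max k1 k2, ?_⟩
      intro Y hY
      rcases hY with hY | hY
      · exact lt_of_lt_of_le (h1 Y hY) (le_max_left _ _)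
      · split_ifs at hY
        · exact lt_of_lt_of_le (h2 Y hY) (le_max_right _ _)
        · exact hY.elim
    | choice e₁ e₂ h1 h2 =>
      obtain ⟨k1, h1⟩ := h1
      obtain ⟨k2, h2⟩ := h2
      refine ⟨max k1 k2, ?_⟩
      intro Y hY
      rcases hY with hY | hY
      · exact lt_of_lt_of_le (h1 Y hY) (le_max_left _ _)
      · exact lt_of_lt_of_le (h2 Y hY) (le_max_right _ _)
    | not e h => exact h
  have main : ∀ n, ∀ k, ∀ e : PExp N A, (∀ Y ∈ e.leftNts, rank Y < k) →
      ∀ w : List A, w.length = n → ∃ r, Parses G e w r := by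
    intro n
    induction n using Nat.strong_induction_on with
    | _ n ihn =>
      intro k
      induction k with
      | zero | succ k ihk =>
        intro e
        induction e with
        | eps => intro _ w _; exact ⟨_, .eps w⟩
        | term a =>
          intro _ w _
          cases w with
          | nil => exact ⟨_, .term_nil a⟩
          | cons b s =>
            by_cases h : a = b
            · subst h; exact ⟨_, .term_ok a s⟩
            · exact ⟨_, .term_mismatch s h⟩
        | nt B =>
          intro h w hw
          have hB := h B (by simp [PExp.leftNts])
          first
          | exact absurd hB (Nat.not_lt_zero _)
          | (obtain ⟨r, h'⟩ := ihk (G.rule B)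
              (fun Y hY => by have := hr B Y hY; omega) w hw
             exact ⟨r, .nt h'⟩)
        | seq e₁ e₂ h1 h2 =>
          intro h w hw
          obtain ⟨r, p1⟩ := h1 (fun Y hY => h Y (Or.inl hY)) w hw
          cases r with
          | none => exact ⟨_, .seq_fail p1⟩
          | some u =>
            have hl := parses_length p1 u rfl
            rcases Nat.lt_or_ge u.length n with hlt | hge
            · obtain ⟨k', hk'⟩ := bdd e₂
              obtain ⟨r, p2⟩ := ihn _ hlt k' e₂ hk' u rfl
              exact ⟨r, .seq_ok p1 p2⟩
            · have hm : e₁.maybeEmpty = true := by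
                by_contra hc
                have := hl.2 (by simpa using hc)
                omega
              obtain ⟨r, p2⟩ := h2 (fun Y hY => h Y (Or.inr (by rw [if_pos hm]; exact hY))) u
                (by omega)
              exact ⟨r, .seq_ok p1 p2⟩
        | choice e₁ e₂ h1 h2 =>
          intro h w hw
          obtain ⟨r, p1⟩ := h1 (fun Y hY => h Y (Or.inl hY)) w hw
          obtain ⟨r', p2⟩ := h2 (fun Y hY => h Y (Or.inr hY)) w hw
          cases r with
          | none => exact ⟨_, .choice_snd p1 p2⟩
          | some u => exact ⟨_, .choice_fst p1⟩
        | not e h1 =>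
          intro h w hw
          obtain ⟨r, p1⟩ := h1 h w hw
          cases r with
          | none => exact ⟨_, .not_succ p1⟩
          | some u => exact ⟨_, .not_fail p1⟩
  obtain ⟨k, hk⟩ := bdd e
  exact main _ k e hk w rfl

theorem wellFormed_of_rank {N A : Type} (G : PEG N A) (rank : N → ℕ)
    (hr : ∀ X Y, Y ∈ (G.rule X).leftNts → rank Y < rank X) : G.WellFormed := by
  intro B h
  have : ∀ X Y, Relation.TransGen (fun X Y : N => Y ∈ (G.rule X).leftNts) X Y →
      rank Y < rank X := by
    intro X Y h
    induction h with
    | single h => exact hr _ _ h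
    | tail _ h ih => exact lt_trans (hr _ _ h) ih
  exact lt_irrefl _ (this B B h)

/-- Declarative (unordered-choice) semantics relative to a specification of the nonterminals. -/
def Gen {N A : Type} (spec : N → List A → List A → Prop) :
    PExp N A → List A → List A → Prop
  | .eps, w, v => v = w
  | .term a, w, v => w = a :: v
  | .nt B, w, v => spec B w v
  | .seq e₁ e₂, w, v => ∃ u, Gen spec e₁ w u ∧ Gen spec e₂ u v
  | .choice e₁ e₂, w, v => Gen spec e₁ w v ∨ Gen spec e₂ w v
  | .not e, w, v => v = w ∧ ¬ ∃ u, Gen spec e w u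

def Fn {N A : Type} (spec : N → List A → List A → Prop) (e : PExp N A) : Prop :=
  ∀ w v v', Gen spec e w v → Gen spec e w v' → v = v'

/-- Every head of a sequence is functional. -/
def SeqFn {N A : Type} (spec : N → List A → List A → Prop) : PExp N A → Prop
  | .eps => True
  | .term _ => True
  | .nt _ => True
  | .seq e₁ e₂ => Fn spec e₁ ∧ SeqFn spec e₁ ∧ SeqFn spec e₂
  | .choice e₁ e₂ => SeqFn spec e₁ ∧ SeqFn spec e₂
  | .not e => SeqFn spec e

theorem parses_gen {N A : Type} {G : PEG N A} {spec : N → List A → List A → Prop}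
    (H : ∀ B w v, spec B w v ↔ Gen spec (G.rule B) w v) (HS : ∀ B, SeqFn spec (G.rule B))
    {e : PExp N A} {w : List A} {r : Option (List A)} (h : Parses G e w r) :
    SeqFn spec e → (∀ v, r = some v → Gen spec e w v) ∧
      (r = none → ∀ v, ¬ Gen spec e w v) := by
  induction h with
  | eps w => intro _; simp [Gen]
  | term_ok a s => intro _; simp [Gen]
  | term_mismatch s h => intro _; simp only [Gen]; exact ⟨by simp, fun _ v hv => h (by cases hv; rfl)⟩
  | term_nil a => intro _; simp [Gen]
  | @nt B w r _ ih =>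
    intro _
    have := ih (HS B)
    simp only [Gen, H]
    exact this
  | seq_ok _ _ ih1 ih2 =>
    rintro ⟨f, s1, s2⟩
    have a := (ih1 s1).1 _ rfl
    have b := ih2 s2
    refine ⟨fun v hv => ⟨_, a, b.1 v hv⟩, ?_⟩
    rintro hr v ⟨u, g1, g2⟩
    have := f _ _ _ a g1
    subst this
    exact b.2 hr v g2
  | seq_fail _ ih =>
    rintro ⟨f, s1, s2⟩
    refine ⟨by simp, ?_⟩
    rintro _ v ⟨u, g1, g2⟩
    exact (ih s1).2 rfl u g1
  | choice_fst _ ih =>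
    rintro ⟨s1, s2⟩
    exact ⟨fun v hv => Or.inl ((ih s1).1 v hv), by simp⟩
  | choice_snd _ _ ih1 ih2 =>
    rintro ⟨s1, s2⟩
    refine ⟨fun v hv => Or.inr ((ih2 s2).1 v hv), ?_⟩
    rintro hr v (g | g)
    · exact (ih1 s1).2 rfl v g
    · exact (ih2 s2).2 hr v g
  | not_succ _ ih =>
    intro s
    refine ⟨?_, by simp⟩
    rintro v ⟨⟩
    exact ⟨rfl, fun ⟨u, hu⟩ => (ih s).2 rfl u hu⟩
  | not_fail _ ih =>
    intro s
    refine ⟨by simp, ?_⟩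
    rintro _ v ⟨_, h⟩
    exact h ⟨_, (ih s).1 _ rfl⟩

/-- The failing expression. -/
def pfail {N A : Type} : PExp N A := .not .eps

theorem gen_pfail {N A : Type} (spec : N → List A → List A → Prop) (w v : List A) :
    ¬ Gen spec pfail w v := by
  rintro ⟨_, h⟩
  exact h ⟨w, rfl⟩

/-- Choice over all elements of a finite type. -/
noncomputable def chooseAll {N A ι : Type} [Finite ι] (f : ι → PExp N A) : PExp N A :=
  (((@Finset.univ ι (Fintype.ofFinite ι)).toList.map f)).foldr .choice pfail

theorem gen_chooseAll {N A ι : Type} [Finite ι] (spec : N → List A → List A → Prop)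
    (f : ι → PExp N A) (w v : List A) :
    Gen spec (chooseAll f) w v ↔ ∃ i, Gen spec (f i) w v := by
  have : ∀ l : List ι, Gen spec ((l.map f).foldr .choice pfail) w v ↔
      ∃ i ∈ l, Gen spec (f i) w v := by
    intro l
    induction l with
    | nil => simp [gen_pfail]
    | cons i l ih => simp [Gen, ih]
  simp [chooseAll, this]

theorem seqFn_chooseAll {N A ι : Type} [Finite ι] (spec : N → List A → List A → Prop)
    (f : ι → PExp N A) (h : ∀ i, SeqFn spec (f i)) : SeqFn spec (chooseAll f) := by
  have : ∀ l : List ι, SeqFn spec ((l.map f).foldr .choice pfail) := by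
    intro l
    induction l with
    | nil => simp [pfail, SeqFn]
    | cons i l ih => exact ⟨h i, ih⟩
  exact this _

theorem leftNts_chooseAll {N A ι : Type} [Finite ι]
    (f : ι → PExp N A) (h : ∀ i, (f i).leftNts = ∅) : (chooseAll f).leftNts = ∅ := by
  have : ∀ l : List ι, ((l.map f).foldr PExp.choice pfail).leftNts = ∅ := by
    intro l
    induction l with
    | nil => simp [pfail, PExp.leftNts]
    | cons i l ih => simp [PExp.leftNts, h i, ih]
  exact this _

/-! ### Part 3: DPDA runs -/

section Runs
variable {Q A Γ : Type}

abbrev DPDA.Steps (M : DPDA Q A Γ) := Relation.ReflTransGen (DPDA.Step M)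

/-- One ε-move, forgetting the input. -/
def DPDA.EStep (M : DPDA Q A Γ) (c d : Q × List Γ) : Prop :=
  ∃ Z γ p β, c.2 = Z :: γ ∧ M.transE c.1 Z = some (p, β) ∧ d = (p, β ++ γ)

abbrev DPDA.ESteps (M : DPDA Q A Γ) := Relation.ReflTransGen (DPDA.EStep M)

theorem det_nf {α : Type} {r : α → α → Prop} (hd : ∀ a b c, r a b → r a c → b = c)
    {a b c : α} (h1 : Relation.ReflTransGen r a b) (h2 : Relation.ReflTransGen r a c)
    (hb : ∀ x, ¬ r b x) (hc : ∀ x, ¬ r c x) : b = c := by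
  induction h1 using Relation.ReflTransGen.head_induction_on with
  | refl =>
    rcases Relation.ReflTransGen.cases_head h2 with h | ⟨x, h, _⟩
    · exact h
    · exact (hb x h).elim
  | head h _ ih =>
    rcases Relation.ReflTransGen.cases_head h2 with h' | ⟨x, h', h''⟩
    · subst h'; exact (hc _ h).elim
    · rw [hd _ _ _ h' h] at h''
      exact ih h''

theorem estep_det (M : DPDA Q A Γ) (a b c : Q × List Γ) (h1 : M.EStep a b) (h2 : M.EStep a c) :
    b = c := by
  obtain ⟨Z, γ, p, β, h, t, rfl⟩ := h1
  obtain ⟨Z', γ', p', β', h', t', rfl⟩ := h2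
  rw [h] at h'
  cases h'
  rw [t] at t'
  cases t'
  rfl

theorem step_det (M : DPDA Q A Γ) (a b c : Q × List Γ × List A) (h1 : M.Step a b)
    (h2 : M.Step a c) : b = c := by
  cases h1 with
  | readA t =>
    cases h2 with
    | readA t' => rw [t] at t'; cases t'; rfl
    | readE t' =>
      have := M.det _ _ (by rw [t']; simp) _ |>.symm.trans t
      cases this
  | readE t =>
    cases h2 with
    | readA t' =>
      have := M.det _ _ (by rw [t]; simp) _ |>.symm.trans t'
      cases this
    | readE t' => rw [t] at t'; cases t'; rfl

theorem step_nil (M : DPDA Q A Γ) (p : Q) (v : List A) (x) : ¬ M.Step (p, [], v) x := by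
  intro h
  cases h

theorem pop_unique (M : DPDA Q A Γ) {c : Q × List Γ × List A} {p p' : Q} {v v' : List A}
    (h1 : M.Steps c (p, [], v)) (h2 : M.Steps c (p', [], v')) : v = v' := by
  have := det_nf (step_det M) h1 h2 (step_nil M _ _) (step_nil M _ _)
  cases this
  rfl

theorem steps_frame (M : DPDA Q A Γ) {c d : Q × List Γ × List A} (δ : List Γ)
    (h : M.Steps c d) : M.Steps (c.1, c.2.1 ++ δ, c.2.2) (d.1, d.2.1 ++ δ, d.2.2) := by
  induction h with
  | refl => exact .refl
  | tail _ s ih =>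
    refine ih.tail ?_
    cases s with
    | readA t => simpa using DPDA.Step.readA (γ := _ ++ δ) t
    | readE t => simpa using DPDA.Step.readE (γ := _ ++ δ) t

theorem steps_append (M : DPDA Q A Γ) {c d : Q × List Γ × List A} (y : List A)
    (h : M.Steps c d) : M.Steps (c.1, c.2.1, c.2.2 ++ y) (d.1, d.2.1, d.2.2 ++ y) := by
  induction h with
  | refl => exact .refl
  | tail _ s ih =>
    refine ih.tail ?_
    cases s with
    | readA t => exact DPDA.Step.readA t
    | readE t => exact DPDA.Step.readE t

theorem steps_prefix (M : DPDA Q A Γ) {c d : Q × List Γ × List A} (h : M.Steps c d) :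
    ∃ x, c.2.2 = x ++ d.2.2 ∧ M.Steps (c.1, c.2.1, x) (d.1, d.2.1, []) := by
  induction h using Relation.ReflTransGen.head_induction_on with
  | refl => exact ⟨[], rfl, .refl⟩
  | head s _ ih =>
    obtain ⟨x, h1, h2⟩ := ih
    cases s with
    | @readA q a Z γ u p β t =>
      refine ⟨a :: x, ?_, h2.head (DPDA.Step.readA t)⟩
      simpa using h1
    | readE t => exact ⟨x, h1, h2.head (DPDA.Step.readE t)⟩

theorem steps_decomp (M : DPDA Q A Γ) {c d : Q × List Γ × List A} (h : M.Steps c d) :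
    ∀ α γ, c.2.1 = α ++ γ →
      (∃ δ, d.2.1 = δ ++ γ ∧ M.Steps (c.1, α, c.2.2) (d.1, δ, d.2.2)) ∨
      (∃ p u, M.Steps (c.1, α, c.2.2) (p, [], u) ∧ M.Steps (p, γ, u) d) := by
  induction h using Relation.ReflTransGen.head_induction_on with
  | refl => intro α γ h; exact Or.inl ⟨α, h, .refl⟩
  | head s hs ih =>
    intro α γ h
    cases α with
    | nil =>
      refine Or.inr ⟨_, _, .refl, ?_⟩
      rw [← List.nil_append γ, ← h]
      exact hs.head s
    | cons Z α =>
      cases s with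
      | @readA q a Z γ' u p β t =>
        cases h
        have st : M.Step (q, Z :: α, a :: u) (p, β ++ α, u) := .readA t
        rcases ih (β ++ α) γ (List.append_assoc β α γ).symm with ⟨δ, h1, h2⟩ | ⟨p, u, h1, h2⟩
        · exact Or.inl ⟨δ, h1, h2.head st⟩
        · exact Or.inr ⟨p, u, h1.head st, h2⟩
      | @readE q Z γ' u p β t =>
        cases h
        have st : M.Step (q, Z :: α, u) (p, β ++ α, u) := .readE t
        rcases ih (β ++ α) γ (List.append_assoc β α γ).symm with ⟨δ, h1, h2⟩ | ⟨p, u, h1, h2⟩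
        · exact Or.inl ⟨δ, h1, h2.head st⟩
        · exact Or.inr ⟨p, u, h1.head st, h2⟩

theorem esteps_steps (M : DPDA Q A Γ) {c d : Q × List Γ} (h : M.ESteps c d) (w : List A) :
    M.Steps (c.1, c.2, w) (d.1, d.2, w) := by
  induction h with
  | refl => exact .refl
  | @tail b d _ s ih =>
    refine ih.tail ?_
    obtain ⟨Z, γ, p, β, h, t, rfl⟩ := s
    rw [h]
    exact DPDA.Step.readE t

/-- Split a run at its first reading move. -/
theorem steps_split (M : DPDA Q A Γ) {c d : Q × List Γ × List A} (h : M.Steps c d) :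
    (d.2.2 = c.2.2 ∧ M.ESteps (c.1, c.2.1) (d.1, d.2.1)) ∨
    ∃ q' Y γ a u q₁ β, M.ESteps (c.1, c.2.1) (q', Y :: γ) ∧ M.transA q' a Y = some (q₁, β) ∧
      c.2.2 = a :: u ∧ M.Steps (q₁, β ++ γ, u) d := by
  induction h using Relation.ReflTransGen.head_induction_on with
  | refl => exact Or.inl ⟨rfl, .refl⟩
  | head s hs ih =>
    cases s with
    | @readA q a Z γ u p β t =>
      exact Or.inr ⟨q, Z, γ, a, u, p, β, .refl, t, rfl, hs⟩
    | @readE q Z γ u p β t =>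
      have st : M.EStep (q, Z :: γ) (p, β ++ γ) := ⟨Z, γ, p, β, rfl, t, rfl⟩
      rcases ih with ⟨h1, h2⟩ | ⟨q', Y, γ', a, u', q₁, β', h1, h2⟩
      · exact Or.inl ⟨h1, h2.head st⟩
      · exact Or.inr ⟨q', Y, γ', a, u', q₁, β', h1.head st, h2⟩

/-- Reading configuration reached by ε-moves. -/
def DPDA.Reach (M : DPDA Q A Γ) (q : Q) (Z : Γ) (c : Q × Γ × List Γ) : Prop :=
  M.ESteps (q, [Z]) (c.1, c.2.1 :: c.2.2) ∧ M.transE c.1 c.2.1 = none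

theorem reach_unique (M : DPDA Q A Γ) {q : Q} {Z : Γ} {c d : Q × Γ × List Γ}
    (h1 : M.Reach q Z c) (h2 : M.Reach q Z d) : c = d := by
  have nf : ∀ c : Q × Γ × List Γ, M.transE c.1 c.2.1 = none →
      ∀ x, ¬ M.EStep (c.1, c.2.1 :: c.2.2) x := by
    rintro c hc x ⟨Z, γ, p, β, h, t, -⟩
    cases h
    rw [hc] at t
    cases t
  have := det_nf (estep_det M) h1.1 h2.1 (nf c h1.2) (nf d h2.2)
  obtain ⟨c1, c2, c3⟩ := c
  obtain ⟨d1, d2, d3⟩ := d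
  simp only [Prod.mk.injEq, List.cons.injEq] at this
  obtain ⟨rfl, rfl, rfl⟩ := this
  rfl

set_option linter.unusedSectionVars false

variable {N : Type} [Finite A]

/-- Run the ε-moves from `(q, [Z])`, read one letter, continue with `k`. -/
noncomputable def readFrom (M : DPDA Q A Γ) (q : Q) (Z : Γ) (k : Q → List Γ → PExp N A) :
    PExp N A :=
  open Classical in
  if h : ∃ c, M.Reach q Z c then
    chooseAll fun a : A =>
      match M.transA h.choose.1 a h.choose.2.1 with
      | none => pfail
      | some (q₁, β) => .seq (.term a) (k q₁ (β ++ h.choose.2.2))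
  else pfail

theorem gen_readFrom (spec : N → List A → List A → Prop) (M : DPDA Q A Γ) (q : Q) (Z : Γ)
    (k : Q → List Γ → PExp N A) (w v : List A) :
    Gen spec (readFrom M q Z k) w v ↔ ∃ q' Y γ a u q₁ β, M.ESteps (q, [Z]) (q', Y :: γ) ∧
      M.transA q' a Y = some (q₁, β) ∧ w = a :: u ∧ Gen spec (k q₁ (β ++ γ)) u v := by
  unfold readFrom
  split_ifs with h
  · rw [gen_chooseAll]
    have hc := h.choose_spec
    constructor
    · rintro ⟨a, ha⟩
      split at ha
      · exact (gen_pfail _ _ _ ha).elim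
      · rename_i q₁ β t
        obtain ⟨u, rfl, hu⟩ := ha
        exact ⟨_, _, _, a, u, q₁, β, hc.1, t, rfl, hu⟩
    · rintro ⟨q', Y, γ, a, u, q₁, β, he, t, rfl, hg⟩
      have hn : M.transE q' Y = none := by
        by_contra hne
        rw [M.det _ _ hne a] at t
        cases t
      have := reach_unique M hc (d := (q', Y, γ)) ⟨he, hn⟩
      refine ⟨a, ?_⟩
      rw [this]
      simp only [t]
      exact ⟨u, rfl, hg⟩
  · constructor
    · exact fun hg => (gen_pfail _ _ _ hg).elim
    · rintro ⟨q', Y, γ, a, u, q₁, β, he, t, rfl, hg⟩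
      refine (h ⟨(q', Y, γ), he, ?_⟩).elim
      by_contra hne
      rw [M.det _ _ hne a] at t
      cases t

theorem seqFn_readFrom (spec : N → List A → List A → Prop) (M : DPDA Q A Γ) (q : Q) (Z : Γ)
    (k : Q → List Γ → PExp N A) (hk : ∀ p γ, SeqFn spec (k p γ)) :
    SeqFn spec (readFrom M q Z k) := by
  unfold readFrom
  split_ifs with h
  · refine seqFn_chooseAll _ _ fun a => ?_
    split
    · simp [pfail, SeqFn]
    · refine ⟨?_, trivial, hk _ _⟩
      intro w v v' h h'
      simp only [Gen] at h h'
      rw [h] at h'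
      cases h'
      rfl
  · simp [pfail, SeqFn]

theorem leftNts_readFrom (M : DPDA Q A Γ) (q : Q) (Z : Γ)
    (k : Q → List Γ → PExp N A) : (readFrom M q Z k).leftNts = ∅ := by
  unfold readFrom
  split_ifs with h
  · refine leftNts_chooseAll _ fun a => ?_
    split
    · simp [pfail, PExp.leftNts]
    · simp [PExp.leftNts, PExp.maybeEmpty]
  · simp [pfail, PExp.leftNts]

variable [Finite Q]

/-- Pop the whole list `γ` starting in `q` and ending in `p`; `T` are the pop-nonterminals. -/
noncomputable def popSeq (T : Q → Γ → Q → N) (p : Q) : Q → List Γ → PExp N A :=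
  open Classical in
  fun q γ => match γ with
  | [] => if q = p then .eps else pfail
  | Z :: γ => chooseAll fun p₁ : Q => .seq (.nt (T q Z p₁)) (popSeq T p p₁ γ)

/-- Accept somewhere while processing the stack `γ` from state `q`. -/
noncomputable def accSeq (M : DPDA Q A Γ) (T : Q → Γ → Q → N) (C : Q → Γ → N) (P : N) :
    Q → List Γ → PExp N A
  | q, [] => if M.final q = true then .nt P else pfail
  | q, Z :: γ => .choice (.nt (C q Z))
      (chooseAll fun p₁ : Q => .seq (.nt (T q Z p₁)) (accSeq M T C P p₁ γ))

theorem gen_popSeq (spec : N → List A → List A → Prop) (M : DPDA Q A Γ) (T : Q → Γ → Q → N)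
    (hT : ∀ q Z p w v, spec (T q Z p) w v ↔ M.Steps (q, [Z], w) (p, [], v)) (p : Q)
    (γ : List Γ) : ∀ (q : Q) (w v : List A),
    Gen spec (popSeq T p q γ) w v ↔ M.Steps (q, γ, w) (p, [], v) := by
  induction γ with
  | nil =>
    intro q w v
    unfold popSeq
    split_ifs with h
    · subst h
      simp only [Gen]
      constructor
      · rintro rfl; exact .refl
      · intro h; exact (pop_unique M (Relation.ReflTransGen.refl) h).symm
    · refine ⟨fun hg => (gen_pfail _ _ _ hg).elim, fun hs => ?_⟩
      have := det_nf (step_det M) hs .refl (step_nil M _ _) (step_nil M _ _)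
      cases this
      exact (h rfl).elim
  | cons Z γ ih =>
    intro q w v
    unfold popSeq
    rw [gen_chooseAll]
    simp only [Gen, ih, hT]
    constructor
    · rintro ⟨p₁, u, h1, h2⟩
      exact (steps_frame M γ h1).trans h2
    · intro h
      rcases steps_decomp M h [Z] γ rfl with ⟨δ, h1, h2⟩ | ⟨p₁, u, h1, h2⟩
      · obtain ⟨rfl, rfl⟩ := List.append_eq_nil_iff.1 h1.symm
        exact ⟨p, v, h2, .refl⟩
      · exact ⟨p₁, u, h1, h2⟩

/-- Acceptance with remaining input in `S`. -/
def DPDA.Acc (M : DPDA Q A Γ) (S : Set (List A)) (c : Q × List Γ × List A) : Prop :=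
  ∃ p δ y, M.Steps c (p, δ, y) ∧ M.final p = true ∧ y ∈ S

theorem gen_accSeq (spec : N → List A → List A → Prop) (M : DPDA Q A Γ) (T : Q → Γ → Q → N)
    (C : Q → Γ → N) (P : N) (S : Set (List A))
    (hT : ∀ q Z p w v, spec (T q Z p) w v ↔ M.Steps (q, [Z], w) (p, [], v))
    (hC : ∀ q Z w v, spec (C q Z) w v ↔ v = [] ∧ M.Acc S (q, [Z], w))
    (hP : ∀ w v, spec P w v ↔ v = [] ∧ w ∈ S)
    (γ : List Γ) : ∀ (q : Q) (w v : List A),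
    Gen spec (accSeq M T C P q γ) w v ↔ v = [] ∧ M.Acc S (q, γ, w) := by
  induction γ with
  | nil =>
    intro q w v
    unfold accSeq
    have key : M.Acc S (q, [], w) ↔ M.final q = true ∧ w ∈ S := by
      constructor
      · rintro ⟨p, δ, y, h, h1, h2⟩
        rcases Relation.ReflTransGen.cases_head h with h | ⟨x, h, _⟩
        · cases h; exact ⟨h1, h2⟩
        · exact (step_nil M _ _ _ h).elim
      · rintro ⟨h1, h2⟩
        exact ⟨q, [], w, .refl, h1, h2⟩
    rw [key]
    split_ifs with h
    · simp [Gen, hP, h]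
    · simp [gen_pfail, h]
  | cons Z γ ih =>
    intro q w v
    unfold accSeq
    simp only [Gen, gen_chooseAll, ih, hT, hC]
    constructor
    · rintro (⟨hv, p, δ, y, h1, h2⟩ | ⟨p₁, u, h1, hv, p, δ, y, h2, h3⟩)
      · exact ⟨hv, p, δ ++ γ, y, steps_frame M γ h1, h2⟩
      · exact ⟨hv, p, δ, y, (steps_frame M γ h1).trans h2, h3⟩
    · rintro ⟨hv, p, δ, y, h1, h2⟩
      rcases steps_decomp M h1 [Z] γ rfl with ⟨δ', h3, h4⟩ | ⟨p₁, u, h3, h4⟩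
      · exact Or.inl ⟨hv, p, δ', y, h4, h2⟩
      · exact Or.inr ⟨p₁, u, h3, hv, p, δ, y, h4, h2⟩

theorem seqFn_popSeq (spec : N → List A → List A → Prop) (M : DPDA Q A Γ) (T : Q → Γ → Q → N)
    (hT : ∀ q Z p w v, spec (T q Z p) w v ↔ M.Steps (q, [Z], w) (p, [], v)) (p : Q)
    (γ : List Γ) : ∀ (q : Q), SeqFn spec (popSeq T p q γ) := by
  induction γ with
  | nil => intro q; unfold popSeq; split_ifs <;> simp [pfail, SeqFn]
  | cons Z γ ih =>
    intro q
    unfold popSeq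
    refine seqFn_chooseAll _ _ fun p₁ => ⟨?_, trivial, ih p₁⟩
    intro w v v' h h'
    exact pop_unique M ((hT _ _ _ _ _).1 h) ((hT _ _ _ _ _).1 h')

theorem seqFn_accSeq (spec : N → List A → List A → Prop) (M : DPDA Q A Γ) (T : Q → Γ → Q → N)
    (C : Q → Γ → N) (P : N)
    (hT : ∀ q Z p w v, spec (T q Z p) w v ↔ M.Steps (q, [Z], w) (p, [], v))
    (γ : List Γ) : ∀ (q : Q), SeqFn spec (accSeq M T C P q γ) := by
  induction γ with
  | nil => intro q; unfold accSeq; split_ifs <;> simp [pfail, SeqFn]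
  | cons Z γ ih =>
    intro q
    unfold accSeq
    refine ⟨trivial, seqFn_chooseAll _ _ fun p₁ => ⟨?_, trivial, ih p₁⟩⟩
    intro w v v' h h'
    exact pop_unique M ((hT _ _ _ _ _).1 h) ((hT _ _ _ _ _).1 h')

end Runs

/-! ### Part 4: the grammar -/

section Grammar
variable {A I E : Type} {Q Γ : E → Type}

/-- Nonterminals: suffix predicates, pop-nonterminals, acceptance nonterminals. -/
abbrev GNt (I : Type) {E : Type} (Q Γ : E → Type) : Type :=
  I ⊕ (Σ e : E, Q e × Γ e × Q e) ⊕ (Σ e : E, Q e × Γ e)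

def ntP (i : I) : GNt I Q Γ := .inl i
def ntT (e : E) (q : Q e) (Z : Γ e) (p : Q e) : GNt I Q Γ := .inr (.inl ⟨e, q, Z, p⟩)
def ntC (e : E) (q : Q e) (Z : Γ e) : GNt I Q Γ := .inr (.inr ⟨e, q, Z⟩)

def gspec (M : ∀ e, DPDA (Q e) A (Γ e)) (S : I → Set (List A)) (tgt : E → I) :
    GNt I Q Γ → List A → List A → Prop
  | .inl i, w, v => v = [] ∧ w ∈ S i
  | .inr (.inl ⟨e, q, Z, p⟩), w, v => (M e).Steps (q, [Z], w) (p, [], v)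
  | .inr (.inr ⟨e, q, Z⟩), w, v => v = [] ∧ (M e).Acc (S (tgt e)) (q, [Z], w)

variable [Finite A] [Finite E] [∀ e, Finite (Q e)]

open Classical in
noncomputable def grule (M : ∀ e, DPDA (Q e) A (Γ e)) (S : I → Set (List A)) (src tgt : E → I) :
    GNt I Q Γ → PExp (GNt I Q Γ) A
  | .inl i => .choice
      (if [] ∈ S i then .not (chooseAll fun a : A => .term a) else pfail)
      (chooseAll fun e : E => if src e = i then
        readFrom (M e) (M e).init (M e).Z0 (accSeq (M e) (ntT e) (ntC e) (ntP (tgt e)))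
        else pfail)
  | .inr (.inl ⟨e, q, Z, p⟩) => .choice
      (if (M e).ESteps (q, [Z]) (p, []) then .eps else pfail)
      (readFrom (M e) q Z (popSeq (ntT e) p))
  | .inr (.inr ⟨e, q, Z⟩) => .choice
      (if ∃ p γ, (M e).ESteps (q, [Z]) (p, γ) ∧ (M e).final p = true then .nt (ntP (tgt e))
        else pfail)
      (readFrom (M e) q Z (accSeq (M e) (ntT e) (ntC e) (ntP (tgt e))))

theorem grule_spec (M : ∀ e, DPDA (Q e) A (Γ e)) (S : I → Set (List A)) (src tgt : E → I)
    (hS : ∀ i w, w ≠ [] → (w ∈ S i ↔ ∃ e, src e = i ∧ ∃ x ∈ (M e).Lang, ∃ y ∈ S (tgt e),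
      x ≠ [] ∧ w = x ++ y)) (B : GNt I Q Γ) (w v : List A) :
    gspec M S tgt B w v ↔ Gen (gspec M S tgt) (grule M S src tgt B) w v := by
  classical
  have hT : ∀ e (q : Q e) (Z : Γ e) (p : Q e) w v, gspec M S tgt (ntT e q Z p) w v ↔
    (M e).Steps (q, [Z], w) (p, [], v) := fun _ _ _ _ _ _ => Iff.rfl
  have hC : ∀ e (q : Q e) (Z : Γ e) w v, gspec M S tgt (ntC e q Z) w v ↔
    v = [] ∧ (M e).Acc (S (tgt e)) (q, [Z], w) := fun _ _ _ _ _ => Iff.rfl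
  have hP : ∀ i w v, gspec M S tgt (ntP i) w v ↔ v = [] ∧ w ∈ S i := fun _ _ _ => Iff.rfl
  have hacc := fun e => gen_accSeq (gspec M S tgt) (M e) (ntT e) (ntC e) (ntP (tgt e))
    (S (tgt e)) (hT e) (hC e) (hP (tgt e))
  match B with
  | .inl i =>
    have h1 : Gen (gspec M S tgt) (if [] ∈ S i then .not (chooseAll fun a : A => .term a)
        else pfail) w v ↔ v = [] ∧ w = [] ∧ [] ∈ S i := by
      split_ifs with h
      · simp only [Gen, gen_chooseAll]
        constructor
        · rintro ⟨rfl, hn⟩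
          cases v with
          | nil => exact ⟨rfl, rfl, h⟩
          | cons a v => exact (hn ⟨v, a, rfl⟩).elim
        · rintro ⟨rfl, rfl, _⟩
          simp
      · simp [gen_pfail, h]
    simp only [grule, gspec, Gen, h1, gen_chooseAll]
    constructor
    · rintro ⟨rfl, hw⟩
      by_cases hn : w = []
      · subst hn; exact Or.inl ⟨rfl, rfl, hw⟩
      · right
        obtain ⟨e, he, x, ⟨p, γ, hx, hf⟩, y, hy, hne, rfl⟩ := (hS i w hn).1 hw
        refine ⟨e, ?_⟩
        rw [if_pos he, gen_readFrom]
        have hs := steps_append (M e) y hx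
        rcases steps_split (M e) hs with ⟨h, _⟩ | ⟨q', Y, γ', a, u, q₁, β, h1, h2, h3, h4⟩
        · simp at h; exact (hne h).elim
        · exact ⟨q', Y, γ', a, u, q₁, β, h1, h2, h3, (hacc e _ _ _ _).2
            ⟨rfl, p, γ, y, h4, hf, hy⟩⟩
    · rintro (⟨rfl, rfl, h⟩ | ⟨e, h⟩)
      · exact ⟨rfl, h⟩
      · split_ifs at h with he
        · rw [gen_readFrom] at h
          obtain ⟨q', Y, γ', a, u, q₁, β, hr, h2, rfl, h4⟩ := h
          obtain ⟨rfl, p, δ, y, h5, hf, hy⟩ := (hacc e _ _ _ _).1 h4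
          refine ⟨rfl, (hS i _ (by simp)).2 ⟨e, he, ?_⟩⟩
          obtain ⟨x, hx, h6⟩ := steps_prefix (M e) h5
          simp only at hx
          refine ⟨a :: x, ⟨p, δ, ?_, hf⟩, y, hy, by simp, by simp [hx]⟩
          exact (esteps_steps (M e) hr (a :: x)).trans (h6.head (.readA h2))
        · exact (gen_pfail _ _ _ h).elim
  | .inr (.inl ⟨e, q, Z, p⟩) =>
    simp only [grule, gspec, Gen, gen_readFrom, gen_popSeq (gspec M S tgt) (M e) (ntT e) (hT e)]
    constructor
    · intro hs
      rcases steps_split (M e) hs with ⟨h, h'⟩ | h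
      · left
        simp only at h h'
        rw [if_pos h']
        exact h
      · exact Or.inr h
    · rintro (h | ⟨q', Y, γ', a, u, q₁, β, h1, h2, rfl, h4⟩)
      · split_ifs at h with he
        · cases h
          exact esteps_steps (M e) he _
        · exact (gen_pfail _ _ _ h).elim
      · exact (esteps_steps (M e) h1 _).trans (h4.head (.readA h2))
  | .inr (.inr ⟨e, q, Z⟩) =>
    simp only [grule, gspec, Gen, gen_readFrom, hacc]
    constructor
    · rintro ⟨rfl, p, δ, y, hs, hf, hy⟩
      rcases steps_split (M e) hs with ⟨h, h'⟩ | ⟨q', Y, γ', a, u, q₁, β, h1, h2, h3, h4⟩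
      · left
        simp only at h h'
        rw [if_pos ⟨p, δ, h', hf⟩]
        exact ⟨rfl, h ▸ hy⟩
      · exact Or.inr ⟨q', Y, γ', a, u, q₁, β, h1, h2, h3, rfl, p, δ, y, h4, hf, hy⟩
    · rintro (h | ⟨q', Y, γ', a, u, q₁, β, h1, h2, rfl, rfl, p, δ, y, h4, hf, hy⟩)
      · split_ifs at h with he
        · obtain ⟨p, γ, h1, h2⟩ := he
          obtain ⟨rfl, hw⟩ := h
          exact ⟨rfl, p, γ, w, esteps_steps (M e) h1 _, h2, hw⟩
        · exact (gen_pfail _ _ _ h).elim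
      · exact ⟨rfl, p, δ, y, (esteps_steps (M e) h1 _).trans (h4.head (.readA h2)), hf, hy⟩

theorem grule_seqFn (M : ∀ e, DPDA (Q e) A (Γ e)) (S : I → Set (List A)) (src tgt : E → I)
    (B : GNt I Q Γ) : SeqFn (gspec M S tgt) (grule M S src tgt B) := by
  have hT : ∀ e (q : Q e) (Z : Γ e) (p : Q e) w v, gspec M S tgt (ntT e q Z p) w v ↔
    (M e).Steps (q, [Z], w) (p, [], v) := fun _ _ _ _ _ _ => Iff.rfl
  have hacc := fun e q γ => seqFn_accSeq (gspec M S tgt) (M e) (ntT e) (ntC e) (ntP (tgt e))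
    (hT e) γ q
  match B with
  | .inl i =>
    refine ⟨?_, seqFn_chooseAll _ _ fun e => ?_⟩
    · split_ifs
      · exact seqFn_chooseAll _ _ fun a => trivial
      · trivial
    · split_ifs
      · exact seqFn_readFrom _ _ _ _ _ (hacc e)
      · trivial
  | .inr (.inl ⟨e, q, Z, p⟩) =>
    refine ⟨?_, seqFn_readFrom _ _ _ _ _ fun q γ =>
      seqFn_popSeq (gspec M S tgt) (M e) (ntT e) (hT e) p γ q⟩
    split_ifs <;> trivial
  | .inr (.inr ⟨e, q, Z⟩) =>
    refine ⟨?_, seqFn_readFrom _ _ _ _ _ (hacc e)⟩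
    split_ifs <;> trivial

def grank : GNt I Q Γ → ℕ
  | .inl _ => 0
  | .inr _ => 1

theorem grule_rank (M : ∀ e, DPDA (Q e) A (Γ e)) (S : I → Set (List A)) (src tgt : E → I)
    (X Y : GNt I Q Γ) (h : Y ∈ (grule M S src tgt X).leftNts) : grank Y < grank X := by
  match X with
  | .inl i =>
    exfalso
    rcases h with h | h
    · split_ifs at h
      · simp only [PExp.leftNts] at h
        rw [leftNts_chooseAll _ (fun a => rfl)] at h
        exact h
      · exact h
    · rw [leftNts_chooseAll] at h
      · exact h
      · intro e
        split_ifs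
        · exact leftNts_readFrom _ _ _ _
        · rfl
  | .inr (.inl ⟨e, q, Z, p⟩) =>
    exfalso
    rcases h with h | h
    · split_ifs at h <;> exact h
    · rw [leftNts_readFrom] at h
      exact h
  | .inr (.inr ⟨e, q, Z⟩) =>
    rcases h with h | h
    · split_ifs at h
      · cases h
        exact Nat.zero_lt_one
      · exact h.elim
    · rw [leftNts_readFrom] at h
      exact h.elim

theorem isPEL_of_system [Finite I] [∀ e, Finite (Γ e)] (M : ∀ e, DPDA (Q e) A (Γ e))
    (S : I → Set (List A)) (src tgt : E → I)
    (hS : ∀ i w, w ≠ [] → (w ∈ S i ↔ ∃ e, src e = i ∧ ∃ x ∈ (M e).Lang, ∃ y ∈ S (tgt e),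
      x ≠ [] ∧ w = x ++ y)) (i : I) : IsPEL (S i) := by
  refine ⟨GNt I Q Γ, inferInstance, ⟨grule M S src tgt, ntP i⟩,
    wellFormed_of_rank _ grank (grule_rank M S src tgt), ?_⟩
  have key := fun {w r} => parses_gen (G := ⟨grule M S src tgt, ntP i⟩)
    (grule_spec M S src tgt hS) (grule_seqFn M S src tgt) (e := .nt (ntP i)) (w := w) (r := r)
  ext w
  constructor
  · intro h
    exact ((key h trivial).1 _ rfl).2
  · intro hw
    obtain ⟨r, hr⟩ := parses_total ⟨grule M S src tgt, ntP i⟩ grank (grule_rank M S src tgt)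
      (.nt (ntP i)) w
    have k := key hr trivial
    cases r with
    | none => exact (k.2 rfl [] ⟨rfl, hw⟩).elim
    | some v =>
      have hv : v = [] := (k.1 v rfl).1
      subst hv
      exact hr

end Grammar

theorem isPEL_of_good {A : Type} [Finite A] {F : Set (Set (List A))} (hF : Good F)
    {L : Set (List A)} (hL : L ∈ F) : IsPEL L := by
  obtain ⟨hfin, h⟩ := hF
  have : Finite F := hfin
  have h' : ∀ i : F, ∃ es : List (Set (List A) × Set (List A)),
    (∀ e ∈ es, IsDCFL e.1 ∧ e.2 ∈ F) ∧ ∀ w, w ≠ [] → (w ∈ i.1 ↔ Fac es w) :=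
    fun i => h i.1 i.2
  choose es h1 h2 using h'
  let E := Σ i : F, Fin (es i).length
  have hE : ∀ e : E, IsDCFL ((es e.1)[e.2]).1 ∧ ((es e.1)[e.2]).2 ∈ F :=
    fun e => h1 e.1 _ (List.getElem_mem _)
  choose Q Γ hQ hΓ M hM using fun e => (hE e).1
  refine isPEL_of_system (I := F) (E := E) (Q := Q) (Γ := Γ) M (fun i => i.1) (fun e => e.1)
    (fun e => ⟨_, (hE e).2⟩) ?_ ⟨L, hL⟩
  intro i w hw
  rw [h2 i w hw]
  constructor
  · rintro ⟨e, he, x, hx, y, hy, hne, rfl⟩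
    obtain ⟨n, hn, rfl⟩ := List.getElem_of_mem he
    exact ⟨⟨i, n, hn⟩, rfl, x, by rw [hM]; exact hx, y, hy, hne, rfl⟩
  · rintro ⟨⟨i, n⟩, rfl, x, hx, y, hy, hne, rfl⟩
    rw [hM] at hx
    exact ⟨_, List.getElem_mem n.2, x, hx, y, hy, hne, rfl⟩

/-- The regular closure of the DCFLs is contained in the class of
parsing expression languages. -/
theorem regClosure_dcfl_subset_pel {A : Type} [Finite A] (L : Set (List A))
    (hL : RegClosureDCFL L) : IsPEL L := by
  obtain ⟨F, hF, hm⟩ := exists_good hL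
  exact isPEL_of_good hF hm
end

section
/- The Boolean closure of the regular closure of the deterministic context-free languages is contained in the class of parsing expression languages: Γ_Bool(Γ_REG(DCFL)) ⊆ PEL. -/
/-- The Boolean closure of a class `C` of languages: the smallest class containing
`C` and closed under union, intersection and complement. -/
inductive BoolClosure {A : Type} (C : Set (List A) → Prop) : Set (List A) → Prop where
  | base {L : Set (List A)} : C L → BoolClosure C L
  | union {L₁ L₂ : Set (List A)} :
      BoolClosure C L₁ → BoolClosure C L₂ → BoolClosure C (L₁ ∪ L₂)
  | inter {L₁ L₂ : Set (List A)} :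
      BoolClosure C L₁ → BoolClosure C L₂ → BoolClosure C (L₁ ∩ L₂)
  | compl {L : Set (List A)} : BoolClosure C L → BoolClosure C Lᶜ

namespace PELProof
open Relation

set_option linter.unusedSectionVars false

variable {N A : Type}

/-- On input `w`, the expression `e` yields the results described by `R`, or fails if none. -/
def Dec (G : PEG N A) (e : PExp N A) (w : List A) (R : List A → Prop) : Prop :=
  (∀ w', R w' → Parses G e w (some w')) ∧ ((∀ w', ¬ R w') → Parses G e w none)

def Func (R : List A → Prop) : Prop := ∀ x y, R x → R y → x = y

theorem Dec.congr {G : PEG N A} {e : PExp N A} {w : List A} {R R' : List A → Prop}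
    (h : Dec G e w R) (hR : ∀ w', R w' ↔ R' w') : Dec G e w R' := by
  have : R = R' := by funext x; exact propext (hR x)
  exact this ▸ h

def failE : PExp N A := .not .eps

theorem dec_fail (G : PEG N A) (w : List A) {R : List A → Prop} (h : ∀ w', ¬ R w') :
    Dec G failE w R :=
  ⟨fun w' hw => (h w' hw).elim, fun _ => .not_fail (.eps w)⟩

theorem dec_eps (G : PEG N A) (w : List A) : Dec G .eps w (fun w' => w' = w) :=
  ⟨fun w' hw => hw ▸ .eps w', fun h => (h w rfl).elim⟩

theorem dec_term (G : PEG N A) (a : A) (w : List A) :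
    Dec G (.term a) w (fun w' => w = a :: w') := by
  refine ⟨fun w' hw => hw ▸ .term_ok a w', fun h => ?_⟩
  cases w with
  | nil => exact .term_nil a
  | cons b s =>
    refine .term_mismatch s ?_
    rintro rfl
    exact h s rfl

theorem dec_nt {G : PEG N A} {B : N} {w : List A} {R : List A → Prop}
    (h : Dec G (G.rule B) w R) : Dec G (.nt B) w R :=
  ⟨fun w' hw => .nt (h.1 w' hw), fun hn => .nt (h.2 hn)⟩

theorem dec_seq {G : PEG N A} {e₁ e₂ : PExp N A} {w : List A} {R₁ : List A → Prop}
    {R₂ : List A → List A → Prop}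
    (h₁ : Dec G e₁ w R₁) (h₂ : ∀ w₁, R₁ w₁ → Dec G e₂ w₁ (R₂ w₁)) :
    Dec G (.seq e₁ e₂) w (fun w' => ∃ w₁, R₁ w₁ ∧ R₂ w₁ w') := by
  constructor
  · rintro w' ⟨w₁, a, b⟩
    exact .seq_ok (h₁.1 _ a) ((h₂ _ a).1 _ b)
  · intro hn
    by_cases hx : ∃ w₁, R₁ w₁
    · obtain ⟨w₁, a⟩ := hx
      exact .seq_ok (h₁.1 _ a) ((h₂ _ a).2 fun w' b => hn w' ⟨w₁, a, b⟩)
    · exact .seq_fail (h₁.2 fun w' a => hx ⟨w', a⟩)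

theorem dec_choice {G : PEG N A} {e₁ e₂ : PExp N A} {w : List A} {R₁ R₂ : List A → Prop}
    (h₁ : Dec G e₁ w R₁) (h₂ : Dec G e₂ w R₂) (hf : Func (fun w' => R₁ w' ∨ R₂ w')) :
    Dec G (.choice e₁ e₂) w (fun w' => R₁ w' ∨ R₂ w') := by
  constructor
  · intro w' h
    by_cases hx : ∃ w₁, R₁ w₁
    · obtain ⟨w₁, a⟩ := hx
      obtain rfl := hf _ _ h (Or.inl a)
      exact .choice_fst (h₁.1 _ a)
    · rcases h with h | h
      · exact (hx ⟨_, h⟩).elim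
      · exact .choice_snd (h₁.2 fun w' a => hx ⟨w', a⟩) (h₂.1 _ h)
  · intro hn
    exact .choice_snd (h₁.2 fun w' a => hn w' (Or.inl a)) (h₂.2 fun w' a => hn w' (Or.inr a))

theorem dec_not {G : PEG N A} {e : PExp N A} {w : List A} {R : List A → Prop}
    (h : Dec G e w R) : Dec G (.not e) w (fun w' => w' = w ∧ ∀ x, ¬ R x) := by
  constructor
  · rintro w' ⟨rfl, hx⟩
    exact .not_succ (h.2 hx)
  · intro hn
    have : ∃ x, R x := by
      by_contra hc
      exact hn w ⟨rfl, fun x hx => hc ⟨x, hx⟩⟩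
    obtain ⟨x, hx⟩ := this
    exact .not_fail (h.1 x hx)

def bigC {ι : Type} (l : List ι) (f : ι → PExp N A) : PExp N A :=
  l.foldr (fun i e => .choice (f i) e) failE

theorem dec_bigC {ι : Type} {G : PEG N A} (l : List ι) (f : ι → PExp N A) {w : List A}
    {R : ι → List A → Prop} (h : ∀ i, Dec G (f i) w (R i)) (hf : Func (fun w' => ∃ i, R i w')) :
    Dec G (bigC l f) w (fun w' => ∃ i ∈ l, R i w') := by
  induction l with
  | nil => exact dec_fail _ _ (by simp)
  | cons i l ih =>
    refine (dec_choice (h i) ih ?_).congr (by simp)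
    intro x y hx hy
    refine hf x y ?_ ?_
    · rcases hx with hx | ⟨j, _, hx⟩ <;> exact ⟨_, hx⟩
    · rcases hy with hx | ⟨j, _, hx⟩ <;> exact ⟨_, hx⟩

noncomputable def finC {ι : Type} [Finite ι] (f : ι → PExp N A) : PExp N A :=
  bigC (@Finset.univ ι (Fintype.ofFinite ι)).toList f

theorem dec_finC {ι : Type} [Finite ι] {G : PEG N A} {f : ι → PExp N A} {w : List A}
    {R : ι → List A → Prop} (h : ∀ i, Dec G (f i) w (R i)) (hf : Func (fun w' => ∃ i, R i w')) :
    Dec G (finC f) w (fun w' => ∃ i, R i w') :=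
  (dec_bigC _ f h hf).congr (by simp)

theorem leftNts_fail : (failE : PExp N A).leftNts = ∅ := rfl

theorem leftNts_bigC {ι : Type} (l : List ι) {f : ι → PExp N A} {T : Set N}
    (h : ∀ i, (f i).leftNts ⊆ T) : (bigC l f).leftNts ⊆ T := by
  induction l with
  | nil => simp [bigC, failE, PExp.leftNts]
  | cons i l ih => exact Set.union_subset (h i) ih

theorem leftNts_finC {ι : Type} [Finite ι] {f : ι → PExp N A} {T : Set N}
    (h : ∀ i, (f i).leftNts ⊆ T) : (finC f).leftNts ⊆ T := leftNts_bigC _ h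

/-! ### DPDA runs -/

section dpda
variable {Q Γ : Type} (M : DPDA Q A Γ)

abbrev Reach : Q × List Γ × List A → Q × List Γ × List A → Prop := ReflTransGen M.Step

def EStep (c d : Q × List Γ) : Prop :=
  ∃ Z γ β, c.2 = Z :: γ ∧ M.transE c.1 Z = some (d.1, β) ∧ d.2 = β ++ γ

abbrev ER : Q × List Γ → Q × List Γ → Prop := ReflTransGen (EStep M)

theorem step_unique : Relator.RightUnique M.Step := by
  intro c d e h₁ h₂
  cases h₁ with
  | readA h =>
    cases h₂ with
    | readA h' => rw [h] at h'; cases h'; rfl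
    | readE h' => have := M.det _ _ (by rw [h']; simp) ; rw [this] at h; cases h
  | readE h =>
    cases h₂ with
    | readA h' => have := M.det _ _ (by rw [h]; simp) ; rw [this] at h'; cases h'
    | readE h' => rw [h] at h'; cases h'; rfl

theorem estep_unique : Relator.RightUnique (EStep M) := by
  rintro ⟨c, γ⟩ ⟨d, γ₁⟩ ⟨e, γ₂⟩ ⟨Z, γ, β, rfl, h, rfl⟩ ⟨Z', γ', β', h1, h', h2⟩
  simp only [List.cons.injEq] at h1 h2 h h'
  obtain ⟨rfl, rfl⟩ := h1
  rw [h] at h'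
  cases h'
  rw [h2]

theorem er_reach {c d : Q × List Γ} (h : ER M c d) (w : List A) :
    Reach M (c.1, c.2, w) (d.1, d.2, w) := by
  induction h with
  | refl => exact .refl
  | tail _ h ih =>
    refine ih.tail ?_
    rename_i b c _
    obtain ⟨b, γ⟩ := b
    obtain ⟨c, γ'⟩ := c
    obtain ⟨Z, γ, β, rfl, h, rfl⟩ := h
    exact .readE h

theorem reach_cases {c d : Q × List Γ × List A} (h : Reach M c d) :
    (ER M (c.1, c.2.1) (d.1, d.2.1) ∧ d.2.2 = c.2.2) ∨
    ∃ q₁ Z₁ γ₁ a u r β, ER M (c.1, c.2.1) (q₁, Z₁ :: γ₁) ∧ c.2.2 = a :: u ∧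
      M.transA q₁ a Z₁ = some (r, β) ∧ Reach M (r, β ++ γ₁, u) d := by
  induction h using ReflTransGen.head_induction_on with
  | refl => exact Or.inl ⟨.refl, rfl⟩
  | head h hr ih =>
    cases h with
    | readA h =>
      exact Or.inr ⟨_, _, _, _, _, _, _, .refl, rfl, h, hr⟩
    | readE h =>
      rename_i q Z γ u p β
      have hs : EStep M (q, Z :: γ) (p, β ++ γ) := ⟨Z, γ, β, rfl, h, rfl⟩
      rcases ih with ⟨h1, h2⟩ | ⟨q₁, Z₁, γ₁, a, u', r, β', h1, h2, h3, h4⟩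
      · exact Or.inl ⟨.head hs h1, h2⟩
      · exact Or.inr ⟨q₁, Z₁, γ₁, a, u', r, β', .head hs h1, h2, h3, h4⟩

theorem reach_of_cases {q : Q} {γ : List Γ} {q₁ : Q} {Z₁ : Γ} {γ₁ : List Γ} {a : A} {u : List A}
    {r : Q} {β : List Γ} {d : Q × List Γ × List A} (h : ER M (q, γ) (q₁, Z₁ :: γ₁))
    (ht : M.transA q₁ a Z₁ = some (r, β)) (hr : Reach M (r, β ++ γ₁, u) d) :
    Reach M (q, γ, a :: u) d :=
  (er_reach M h (a :: u)).trans (.head (.readA ht) hr)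

theorem er_term_unique {c : Q × List Γ} {q₁ q₂ : Q} {Z₁ Z₂ : Γ} {γ₁ γ₂ : List Γ}
    (h₁ : ER M c (q₁, Z₁ :: γ₁)) (t₁ : M.transE q₁ Z₁ = none)
    (h₂ : ER M c (q₂, Z₂ :: γ₂)) (t₂ : M.transE q₂ Z₂ = none) :
    q₁ = q₂ ∧ Z₁ = Z₂ ∧ γ₁ = γ₂ := by
  have key : ∀ {q : Q} {Z : Γ} {γ : List Γ} {d}, M.transE q Z = none →
      ER M (q, Z :: γ) d → (q, Z :: γ) = d := by
    intro q Z γ d t h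
    rcases h.cases_head with h | ⟨x, ⟨Z', γ', β, e1, e2, _⟩, _⟩
    · exact h
    · simp only [List.cons.injEq] at e1 e2
      rw [← e1.1, t] at e2; cases e2
  rcases ReflTransGen.total_of_right_unique (estep_unique M) h₁ h₂ with h | h
  · have := key t₁ h; simpa using this
  · have := key t₂ h; simp only [Prod.mk.injEq, List.cons.injEq] at this
    exact ⟨this.1.symm, this.2.1.symm, this.2.2.symm⟩

theorem reach_halt_unique {c : Q × List Γ × List A} {q₁ q₂ : Q} {w₁ w₂ : List A}
    (h₁ : Reach M c (q₁, [], w₁)) (h₂ : Reach M c (q₂, [], w₂)) : q₁ = q₂ ∧ w₁ = w₂ := by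
  have key : ∀ {q : Q} {w : List A} {d}, Reach M (q, [], w) d → (q, [], w) = d := by
    intro q w d h
    rcases h.cases_head with h | ⟨x, h, _⟩
    · exact h
    · cases h
  rcases ReflTransGen.total_of_right_unique (step_unique M) h₁ h₂ with h | h
  · have := key h; simpa using this
  · have := key h; simp only [Prod.mk.injEq] at this
    exact ⟨this.1.symm, this.2.2.symm⟩

theorem reach_append {c d : Q × List Γ × List A} (h : Reach M c d) (γ : List Γ) :
    Reach M (c.1, c.2.1 ++ γ, c.2.2) (d.1, d.2.1 ++ γ, d.2.2) := by
  induction h with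
  | refl => exact .refl
  | tail _ h ih =>
    refine ih.tail ?_
    cases h with
    | readA h => simpa using DPDA.Step.readA h
    | readE h => simpa using DPDA.Step.readE h

theorem reach_input {c d : Q × List Γ × List A} (h : Reach M c d) (y : List A) :
    Reach M (c.1, c.2.1, c.2.2 ++ y) (d.1, d.2.1, d.2.2 ++ y) := by
  induction h with
  | refl => exact .refl
  | tail _ h ih =>
    refine ih.tail ?_
    cases h with
    | readA h => simpa using DPDA.Step.readA h
    | readE h => simpa using DPDA.Step.readE h

theorem reach_split_input {c d : Q × List Γ × List A} (h : Reach M c d) :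
    ∃ x, c.2.2 = x ++ d.2.2 ∧ Reach M (c.1, c.2.1, x) (d.1, d.2.1, []) := by
  induction h using ReflTransGen.head_induction_on with
  | refl => exact ⟨[], rfl, .refl⟩
  | head h hr ih =>
    obtain ⟨x, h1, h2⟩ := ih
    cases h with
    | @readA q a Z γ u p β h =>
      refine ⟨a :: x, ?_, .head (.readA h) h2⟩
      simpa using h1
    | readE h => exact ⟨x, h1, .head (.readE h) h2⟩

theorem reach_len {c d : Q × List Γ × List A} (h : Reach M c d) : d.2.2.length ≤ c.2.2.length := by
  obtain ⟨x, h, _⟩ := reach_split_input M h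
  simp [h]

/-- Splitting a run along the stack. -/
theorem reach_split {q : Q} {γ₁ γ₂ : List Γ} {w : List A} {d : Q × List Γ × List A}
    (h : Reach M (q, γ₁ ++ γ₂, w) d) :
    (∃ γ', d.2.1 = γ' ++ γ₂ ∧ Reach M (q, γ₁, w) (d.1, γ', d.2.2)) ∨
    ∃ r w₁, Reach M (q, γ₁, w) (r, [], w₁) ∧ Reach M (r, γ₂, w₁) d := by
  generalize hc : (q, γ₁ ++ γ₂, w) = c at h
  induction h using ReflTransGen.head_induction_on generalizing q γ₁ w with
  | refl => subst hc; exact Or.inl ⟨γ₁, rfl, .refl⟩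
  | head h hr ih =>
    subst hc
    cases γ₁ with
    | nil => exact Or.inr ⟨q, w, .refl, .head h hr⟩
    | cons Z γ =>
      cases h with
      | readA h =>
        rcases ih (γ₁ := _ ++ γ) (by rw [List.append_assoc]; rfl) with ⟨γ', h1, h2⟩ | ⟨r, w₁, h1, h2⟩
        · exact Or.inl ⟨γ', h1, .head (.readA h) h2⟩
        · exact Or.inr ⟨r, w₁, .head (.readA h) h1, h2⟩
      | readE h =>
        rcases ih (γ₁ := _ ++ γ) (by rw [List.append_assoc]; rfl) with ⟨γ', h1, h2⟩ | ⟨r, w₁, h1, h2⟩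
        · exact Or.inl ⟨γ', h1, .head (.readE h) h2⟩
        · exact Or.inr ⟨r, w₁, .head (.readE h) h1, h2⟩

/-- `PS q γ p w w'`: started in state `q` with stack `γ`, the stack is emptied in state `p`. -/
def PS (q : Q) (γ : List Γ) (p : Q) (w w' : List A) : Prop := Reach M (q, γ, w) (p, [], w')

theorem PS_func (q : Q) (γ : List Γ) (p : Q) (w : List A) : Func (PS M q γ p w) :=
  fun _ _ h₁ h₂ => (reach_halt_unique M h₁ h₂).2

theorem PS_nil {q p : Q} {w w' : List A} : PS M q [] p w w' ↔ p = q ∧ w' = w := by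
  constructor
  · intro h
    exact reach_halt_unique M h .refl
  · rintro ⟨rfl, rfl⟩; exact .refl

theorem PS_cons {q p : Q} {Z : Γ} {γ : List Γ} {w w' : List A} :
    PS M q (Z :: γ) p w w' ↔ ∃ r w₁, PS M q [Z] r w w₁ ∧ PS M r γ p w₁ w' := by
  constructor
  · intro h
    rcases reach_split M (γ₁ := [Z]) h with ⟨γ', h1, h2⟩ | h
    · simp only [List.nil_eq, List.append_eq_nil_iff] at h1
      obtain ⟨rfl, rfl⟩ := h1
      exact ⟨p, w', h2, .refl⟩
    · exact h
  · rintro ⟨r, w₁, h1, h2⟩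
    exact (reach_append M h1 γ).trans h2

/-- A final state is reachable with the remaining input in `Y`. -/
def AS (Y : List A → Prop) (q : Q) (γ : List Γ) (w : List A) : Prop :=
  ∃ p γ' w', Reach M (q, γ, w) (p, γ', w') ∧ M.final p = true ∧ Y w'

theorem AS_nil {Y : List A → Prop} {q : Q} {w : List A} :
    AS M Y q [] w ↔ M.final q = true ∧ Y w := by
  constructor
  · rintro ⟨p, γ', w', h, h1, h2⟩
    rcases h.cases_head with h | ⟨x, h, _⟩
    · cases h; exact ⟨h1, h2⟩
    · cases h
  · rintro ⟨h1, h2⟩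
    exact ⟨_, _, _, .refl, h1, h2⟩

theorem AS_cons {Y : List A → Prop} {q : Q} {Z : Γ} {γ : List Γ} {w : List A} :
    AS M Y q (Z :: γ) w ↔ AS M Y q [Z] w ∨ ∃ r w₁, PS M q [Z] r w w₁ ∧ AS M Y r γ w₁ := by
  constructor
  · rintro ⟨p, γ', w', h, h1, h2⟩
    rcases reach_split M (γ₁ := [Z]) h with ⟨γ'', _, h4⟩ | ⟨r, w₁, h3, h4⟩
    · exact Or.inl ⟨_, _, _, h4, h1, h2⟩
    · exact Or.inr ⟨r, w₁, h3, _, _, _, h4, h1, h2⟩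
  · rintro (⟨p, γ', w', h, h1, h2⟩ | ⟨r, w₁, h, p, γ', w', h3, h1, h2⟩)
    · exact ⟨_, _, _, reach_append M h γ, h1, h2⟩
    · exact ⟨_, _, _, (reach_append M h γ).trans h3, h1, h2⟩

/-! ### The expressions simulating a DPDA -/

def IsNF (q : Q) (Z : Γ) (x : Q × Γ × List Γ) : Prop :=
  ER M (q, [Z]) (x.1, x.2.1 :: x.2.2) ∧ M.transE x.1 x.2.1 = none

open Classical in
noncomputable def nf (q : Q) (Z : Γ) : Option (Q × Γ × List Γ) :=
  if h : ∃ x, IsNF M q Z x then some h.choose else none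

theorem nf_eq_some {q : Q} {Z : Γ} {x : Q × Γ × List Γ} : nf M q Z = some x ↔ IsNF M q Z x := by
  unfold nf
  split_ifs with h
  · have hs := h.choose_spec
    constructor
    · intro e
      cases e
      exact hs
    · intro hx
      obtain ⟨h1, h2, h3⟩ := er_term_unique M hs.1 hs.2 hx.1 hx.2
      congr 1
      exact Prod.ext h1 (Prod.ext h2 h3)
  · simp only [false_iff]
    exact fun hx => h ⟨x, hx⟩

noncomputable def readE [Finite A] (k : Q → List Γ → PExp N A) (q : Q) (Z : Γ) : PExp N A :=
  match nf M q Z with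
  | none => failE
  | some x => finC fun a => .seq (.term a)
      (match M.transA x.1 a x.2.1 with
        | none => failE
        | some y => k y.1 (y.2 ++ x.2.2))

theorem leftNts_readE [Finite A] (k : Q → List Γ → PExp N A) (q : Q) (Z : Γ) :
    (readE M k q Z).leftNts = ∅ := by
  unfold readE
  split
  · rfl
  · rw [← Set.subset_empty_iff]
    apply leftNts_finC
    intro a
    simp [PExp.leftNts, PExp.maybeEmpty]

theorem dec_readE [Finite A] {G : PEG N A} {k : Q → List Γ → PExp N A} {q : Q} {Z : Γ}
    {w : List A} {K : Q → List Γ → List A → List A → Prop}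
    (hk : ∀ r γ u, u.length < w.length → Dec G (k r γ) u (K r γ u))
    (hf : ∀ r γ u, Func (K r γ u)) :
    Dec G (readE M k q Z) w (fun w' => ∃ q₁ Z₁ γ₁ a u r β, ER M (q, [Z]) (q₁, Z₁ :: γ₁) ∧
      w = a :: u ∧ M.transA q₁ a Z₁ = some (r, β) ∧ K r (β ++ γ₁) u w') := by
  have hnone : ∀ {q₁ a Z₁ r β}, M.transA q₁ a Z₁ = some (r, β) → M.transE q₁ Z₁ = none := by
    intro q₁ a Z₁ r β h
    by_contra hc
    rw [M.det _ _ hc a] at h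
    cases h
  unfold readE
  split
  · rename_i hn
    refine dec_fail _ _ ?_
    rintro w' ⟨q₁, Z₁, γ₁, a, u, r, β, h1, _, h3, _⟩
    have := (nf_eq_some M (x := (q₁, Z₁, γ₁))).2 ⟨h1, hnone h3⟩
    rw [this] at hn
    cases hn
  · rename_i x hx
    obtain ⟨q₁, Z₁, γ₁⟩ := x
    have hx' := (nf_eq_some M).1 hx
    refine (dec_finC (R := fun a w' => ∃ u, w = a :: u ∧ ∃ y, M.transA q₁ a Z₁ = some y ∧
      K y.1 (y.2 ++ γ₁) u w') ?_ ?_).congr ?_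
    · intro a
      refine dec_seq (dec_term G a w) ?_
      rintro u rfl
      simp only
      split
      · rename_i h
        refine dec_fail _ _ ?_
        simp [h]
      · rename_i y h
        refine (hk _ _ _ (by simp)).congr ?_
        simp [h]
    · rintro x y ⟨a, u, rfl, z, h1, h2⟩ ⟨a', u', e, z', h1', h2'⟩
      cases e
      rw [h1] at h1'
      cases h1'
      exact hf _ _ _ _ _ h2 h2'
    · intro w'
      constructor
      · rintro ⟨a, u, h1, ⟨r, β⟩, h2, h3⟩
        exact ⟨q₁, Z₁, γ₁, a, u, r, β, hx'.1, h1, h2, h3⟩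
      · rintro ⟨q₂, Z₂, γ₂, a, u, r, β, h1, h2, h3, h4⟩
        obtain ⟨rfl, rfl, rfl⟩ := er_term_unique M hx'.1 hx'.2 h1 (hnone h3)
        exact ⟨a, u, h2, (r, β), h3, h4⟩

section rules
variable [Finite A] [Finite Q] (pop : Q → Γ → Q → N) (acc : Q → Γ → N) (Yn : N)

open Classical in
noncomputable def popSeq (p : Q) : Q → List Γ → PExp N A
  | r, [] => if p = r then .eps else failE
  | r, Z :: γ => finC fun r₁ : Q => .seq (.nt (pop r Z r₁)) (popSeq p r₁ γ)

open Classical in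
noncomputable def popRule (q : Q) (Z : Γ) (p : Q) : PExp N A :=
  if ER M (q, [Z]) (p, []) then .eps else readE M (popSeq pop p) q Z

open Classical in
noncomputable def accSeq : Q → List Γ → PExp N A
  | r, [] => if M.final r = true then .nt Yn else failE
  | r, Z :: γ => .choice (.nt (acc r Z))
      (finC fun r₁ : Q => .seq (.nt (pop r Z r₁)) (accSeq r₁ γ))

noncomputable def startExp (q : Q) (Z : Γ) : PExp N A := readE M (accSeq M pop acc Yn) q Z

open Classical in
noncomputable def accRule (q : Q) (Z : Γ) : PExp N A :=
  .choice (if ∃ p γ, ER M (q, [Z]) (p, γ) ∧ M.final p = true then .nt Yn else failE)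
    (startExp M pop acc Yn q Z)

theorem leftNts_popRule (q : Q) (Z : Γ) (p : Q) : (popRule M pop q Z p).leftNts = ∅ := by
  unfold popRule
  split_ifs
  · rfl
  · exact leftNts_readE M _ _ _

theorem leftNts_startExp (q : Q) (Z : Γ) : (startExp M pop acc Yn q Z).leftNts = ∅ :=
  leftNts_readE M _ _ _

theorem leftNts_accRule (q : Q) (Z : Γ) : (accRule M pop acc Yn q Z).leftNts ⊆ {Yn} := by
  unfold accRule
  simp only [PExp.leftNts, leftNts_startExp, Set.union_empty]
  split_ifs <;> simp [PExp.leftNts, failE]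

theorem dec_popSeq {G : PEG N A} (n : ℕ)
    (h : ∀ q Z p w, w.length < n → Dec G (.nt (pop q Z p)) w (PS M q [Z] p w))
    (p : Q) (γ : List Γ) : ∀ (r : Q) (w : List A), w.length < n →
      Dec G (popSeq pop p r γ) w (PS M r γ p w) := by
  induction γ with
  | nil =>
    intro r w _
    unfold popSeq
    split_ifs with hp
    · exact (dec_eps G w).congr (by simp [PS_nil, hp])
    · exact dec_fail _ _ (by simp [PS_nil, hp])
  | cons Z γ ih =>
    intro r w hw
    unfold popSeq
    refine (dec_finC (fun r₁ => dec_seq (h r Z r₁ w hw)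
      (fun w₁ hw₁ => ih r₁ w₁ (lt_of_le_of_lt (reach_len M hw₁) hw))) ?_).congr ?_
    · intro x y hx hy
      exact PS_func M r (Z :: γ) p w _ _ ((PS_cons M).2 hx) ((PS_cons M).2 hy)
    · intro w'
      exact (PS_cons M).symm

theorem dec_pop {G : PEG N A} (hG : ∀ q Z p, G.rule (pop q Z p) = popRule M pop q Z p) (n : ℕ) :
    ∀ q Z p w, w.length < n → Dec G (.nt (pop q Z p)) w (PS M q [Z] p w) := by
  induction n with
  | zero => intro q Z p w h; omega
  | succ n ih =>
    intro q Z p w hw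
    apply dec_nt
    rw [hG]
    unfold popRule
    split_ifs with he
    · refine (dec_eps G w).congr fun w' => ?_
      have hr : PS M q [Z] p w w := er_reach M he w
      exact ⟨fun e => e ▸ hr, fun h => PS_func M _ _ _ _ _ _ h hr⟩
    · refine (dec_readE M (K := fun r γ => PS M r γ p)
        (fun r γ u hu => dec_popSeq M pop n ih p γ r u (by omega))
        (fun r γ u => PS_func M r γ p u)).congr fun w' => ?_
      constructor
      · rintro ⟨q₁, Z₁, γ₁, a, u, r, β, h1, rfl, h3, h4⟩
        exact reach_of_cases M h1 h3 h4
      · intro h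
        rcases reach_cases M h with ⟨h, _⟩ | h
        · exact (he h).elim
        · exact h

variable {Yl : List A → Prop}

theorem dec_accSeq {G : PEG N A} (n : ℕ)
    (hp : ∀ q Z p w, w.length < n → Dec G (.nt (pop q Z p)) w (PS M q [Z] p w))
    (hY : ∀ w, w.length < n → Dec G (.nt Yn) w (fun w' => w' = [] ∧ Yl w))
    (h : ∀ q Z w, w.length < n → Dec G (.nt (acc q Z)) w (fun w' => w' = [] ∧ AS M Yl q [Z] w))
    (γ : List Γ) : ∀ (r : Q) (w : List A), w.length < n →
      Dec G (accSeq M pop acc Yn r γ) w (fun w' => w' = [] ∧ AS M Yl r γ w) := by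
  induction γ with
  | nil =>
    intro r w hw
    unfold accSeq
    split_ifs with hf
    · exact (hY w hw).congr (by simp [AS_nil, hf])
    · exact dec_fail _ _ (by simp [AS_nil, hf])
  | cons Z γ ih =>
    intro r w hw
    unfold accSeq
    refine (dec_choice (h r Z w hw) (dec_finC (fun r₁ => dec_seq (hp r Z r₁ w hw)
      (fun w₁ hw₁ => ih r₁ w₁ (lt_of_le_of_lt (reach_len M hw₁) hw))) ?_) ?_).congr ?_
    · rintro x y ⟨_, _, _, rfl, _⟩ ⟨_, _, _, rfl, _⟩
      rfl
    · rintro x y (⟨rfl, _⟩ | ⟨_, _, _, rfl, _⟩) (⟨rfl, _⟩ | ⟨_, _, _, rfl, _⟩) <;> rfl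
    · intro w'
      rw [AS_cons M (γ := γ)]
      constructor
      · rintro (⟨h1, h2⟩ | ⟨r, w₁, h1, h2, h3⟩)
        · exact ⟨h1, Or.inl h2⟩
        · exact ⟨h2, Or.inr ⟨r, w₁, h1, h3⟩⟩
      · rintro ⟨h2, h | ⟨r, w₁, h1, h3⟩⟩
        · exact Or.inl ⟨h2, h⟩
        · exact Or.inr ⟨r, w₁, h1, h2, h3⟩

theorem dec_start {G : PEG N A} (n : ℕ)
    (hp : ∀ q Z p w, w.length < n → Dec G (.nt (pop q Z p)) w (PS M q [Z] p w))
    (hY : ∀ w, w.length < n → Dec G (.nt Yn) w (fun w' => w' = [] ∧ Yl w))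
    (h : ∀ q Z w, w.length < n → Dec G (.nt (acc q Z)) w (fun w' => w' = [] ∧ AS M Yl q [Z] w))
    (q : Q) (Z : Γ) (w : List A) (hw : w.length < n + 1) :
    Dec G (startExp M pop acc Yn q Z) w (fun w' => w' = [] ∧
      ∃ q₁ Z₁ γ₁ a u r β, ER M (q, [Z]) (q₁, Z₁ :: γ₁) ∧
      w = a :: u ∧ M.transA q₁ a Z₁ = some (r, β) ∧ AS M Yl r (β ++ γ₁) u) := by
  refine (dec_readE M (K := fun r γ u w' => w' = [] ∧ AS M Yl r γ u)
    (fun r γ u hu => dec_accSeq M pop acc Yn n hp hY h γ r u (by omega)) ?_).congr ?_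
  · rintro r γ u x y ⟨rfl, _⟩ ⟨rfl, _⟩; rfl
  · intro w'
    constructor
    · rintro ⟨q₁, Z₁, γ₁, a, u, r, β, h1, h2, h3, h4, h5⟩
      exact ⟨h4, q₁, Z₁, γ₁, a, u, r, β, h1, h2, h3, h5⟩
    · rintro ⟨h4, q₁, Z₁, γ₁, a, u, r, β, h1, h2, h3, h5⟩
      exact ⟨q₁, Z₁, γ₁, a, u, r, β, h1, h2, h3, h4, h5⟩

open Classical in
theorem dec_acc {G : PEG N A} (hG : ∀ q Z, G.rule (acc q Z) = accRule M pop acc Yn q Z)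
    (hpop : ∀ q Z p, G.rule (pop q Z p) = popRule M pop q Z p) (n : ℕ)
    (hY : ∀ w, w.length < n → Dec G (.nt Yn) w (fun w' => w' = [] ∧ Yl w)) :
    ∀ q Z w, w.length < n → Dec G (.nt (acc q Z)) w (fun w' => w' = [] ∧ AS M Yl q [Z] w) := by
  induction n with
  | zero => intro q Z w h; omega
  | succ n ih =>
    intro q Z w hw
    apply dec_nt
    rw [hG]
    unfold accRule
    have ih' := ih (fun w hw => hY w (by omega))
    have hs := dec_start M pop acc Yn n (dec_pop M pop hpop n) (fun w hw => hY w (by omega)) ih' q Z w hw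
    have hfst : Dec G (if ∃ p γ, ER M (q, [Z]) (p, γ) ∧ M.final p = true then .nt Yn else failE) w
        (fun w' => w' = [] ∧ ∃ p γ, ER M (q, [Z]) (p, γ) ∧ M.final p = true ∧ Yl w) := by
      split_ifs with hc
      · obtain ⟨p, γ, hc, hf⟩ := hc
        refine (hY w hw).congr fun w' => ?_
        constructor
        · rintro ⟨a, b⟩; exact ⟨a, p, γ, hc, hf, b⟩
        · rintro ⟨a, _, _, _, _, b⟩; exact ⟨a, b⟩
      · refine dec_fail _ _ ?_
        rintro w' ⟨_, p, γ, h1, h2, _⟩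
        exact hc ⟨p, γ, h1, h2⟩
    refine (dec_choice hfst hs ?_).congr ?_
    · rintro x y (⟨rfl, _⟩ | ⟨rfl, _⟩) (⟨rfl, _⟩ | ⟨rfl, _⟩) <;> rfl
    · intro w'
      rw [← and_or_left]
      refine and_congr_right fun _ => ?_
      constructor
      · rintro (⟨p, γ, h1, h2, h3⟩ | ⟨q₁, Z₁, γ₁, a, u, r, β, h1, rfl, h3, p, γ', w', h4, h5⟩)
        · exact ⟨p, γ, w, er_reach M h1 w, h2, h3⟩
        · exact ⟨p, γ', w', reach_of_cases M h1 h3 h4, h5⟩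
      · rintro ⟨p, γ', w', h, h1, h2⟩
        rcases reach_cases M h with ⟨h3, h4⟩ | ⟨q₁, Z₁, γ₁, a, u, r, β, h3, h4, h5, h6⟩
        · simp only at h4
          subst h4
          exact Or.inl ⟨p, γ', h3, h1, h2⟩
        · exact Or.inr ⟨q₁, Z₁, γ₁, a, u, r, β, h3, h4, h5, p, γ', w', h6, h1, h2⟩

/-- The initial expression recognizes `(L(M) \ ε) Y`. -/
theorem dec_start' {G : PEG N A} (hG : ∀ q Z, G.rule (acc q Z) = accRule M pop acc Yn q Z)
    (hpop : ∀ q Z p, G.rule (pop q Z p) = popRule M pop q Z p) (n : ℕ)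
    (hY : ∀ w, w.length < n → Dec G (.nt Yn) w (fun w' => w' = [] ∧ Yl w))
    (w : List A) (hw : w.length < n + 1) :
    Dec G (startExp M pop acc Yn M.init M.Z0) w (fun w' => w' = [] ∧
      ∃ x y, x ≠ [] ∧ x ∈ M.Lang ∧ Yl y ∧ w = x ++ y) := by
  refine (dec_start M pop acc Yn n (dec_pop M pop hpop n) hY
    (dec_acc M pop acc Yn hG hpop n hY) M.init M.Z0 w hw).congr fun w' => ?_
  refine and_congr_right fun _ => ?_
  constructor
  · rintro ⟨q₁, Z₁, γ₁, a, u, r, β, h1, rfl, h3, p, γ', w', h4, h5, h6⟩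
    obtain ⟨x, e, h⟩ := reach_split_input M h4
    simp only at e
    subst e
    exact ⟨a :: x, w', by simp, ⟨p, γ', reach_of_cases M h1 h3 h, h5⟩, h6, rfl⟩
  · rintro ⟨x, y, hx, ⟨p, γ', h, hf⟩, hy, rfl⟩
    rcases reach_cases M h with ⟨_, h4⟩ | ⟨q₁, Z₁, γ₁, a, u, r, β, h3, h4, h5, h6⟩
    · exact (hx h4.symm).elim
    · simp only at h4
      subst h4
      exact ⟨q₁, Z₁, γ₁, a, u ++ y, r, β, h3, rfl, h5, p, γ', y, reach_input M h6 y, hf, hy⟩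

end rules
end dpda

/-! ### Finite automata with DCFL labels -/

inductive GAcc {S : Type} (D : S → S → Set (List A)) (F : S → Prop) : S → List A → Prop where
  | fin {s : S} : F s → GAcc D F s []
  | step {s t : S} {x y : List A} : x ∈ D s t → GAcc D F t y → GAcc D F s (x ++ y)

def GRec (L : Set (List A)) : Prop :=
  ∃ (S : Type) (_ : Finite S) (_ : Nonempty S) (D : S → S → Set (List A)) (I F : S → Prop),
    (∀ s t, IsDCFL (D s t)) ∧ ∀ w, w ∈ L ↔ ∃ s, I s ∧ GAcc D F s w

/-- The language `{ε}` if `P` holds and `∅` otherwise. -/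
def epsIf (P : Prop) : Set (List A) := {x | x = [] ∧ P}

open Classical in
theorem dcfl_epsIf (P : Prop) : IsDCFL (epsIf P : Set (List A)) := by
  refine ⟨Unit, Unit, inferInstance, inferInstance,
    ⟨fun _ _ _ => none, fun _ _ => none, by simp, (), (), fun _ => decide P⟩, ?_⟩
  ext w
  constructor
  · rintro ⟨p, γ, h, hf⟩
    rcases h.cases_head with h | ⟨x, h, _⟩
    · cases h
      exact ⟨rfl, by simpa using hf⟩
    · cases h with
      | readA h' => cases h'
      | readE h' => cases h'
  · rintro ⟨rfl, h⟩
    exact ⟨(), _, .refl, by simpa using h⟩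

theorem grec_dcfl {L : Set (List A)} (h : IsDCFL L) : GRec L := by
  refine ⟨Bool, inferInstance, inferInstance,
    fun s t => match s, t with
      | false, true => L
      | _, _ => epsIf False, fun s => s = false, fun s => s = true, ?_, ?_⟩
  · intro s t
    cases s <;> cases t <;> first | exact h | exact dcfl_epsIf _
  · intro w
    constructor
    · intro hw
      refine ⟨false, rfl, ?_⟩
      rw [← List.append_nil w]
      exact .step (t := true) hw (.fin rfl)
    · rintro ⟨s, rfl, h⟩
      cases h with
      | fin h => cases h
      | @step _ t x y h1 h2 =>
        cases t with
        | false => exact h1.2.elim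
        | true =>
          cases h2 with
          | fin _ => simpa using h1
          | step h _ => exact h.2.elim

section sum
variable {S₁ S₂ : Type} (D₁ : S₁ → S₁ → Set (List A)) (D₂ : S₂ → S₂ → Set (List A))
  (J : S₁ → S₂ → Prop)

def sumD : S₁ ⊕ S₂ → S₁ ⊕ S₂ → Set (List A)
  | .inl s, .inl t => D₁ s t
  | .inr s, .inr t => D₂ s t
  | .inl s, .inr t => epsIf (J s t)
  | .inr _, .inl _ => epsIf False

theorem dcfl_sumD (h₁ : ∀ s t, IsDCFL (D₁ s t)) (h₂ : ∀ s t, IsDCFL (D₂ s t)) :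
    ∀ s t, IsDCFL (sumD D₁ D₂ J s t) := by
  rintro (s | s) (t | t)
  · exact h₁ s t
  · exact dcfl_epsIf _
  · exact dcfl_epsIf _
  · exact h₂ s t

variable {F₁ : S₁ → Prop} {F₂ : S₂ → Prop}

theorem gacc_sum {o : S₁ ⊕ S₂} {w : List A} (h : GAcc (sumD D₁ D₂ J) (Sum.elim F₁ F₂) o w) :
    match o with
    | .inl s => GAcc D₁ F₁ s w ∨ ∃ x y t, GAcc D₁ (fun s' => J s' t) s x ∧ GAcc D₂ F₂ t y ∧
        w = x ++ y
    | .inr s => GAcc D₂ F₂ s w := by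
  induction h with
  | @fin s h =>
    cases s with
    | inl s => exact Or.inl (.fin h)
    | inr s => exact .fin h
  | @step s t x y h1 h2 ih =>
    cases s with
    | inl s =>
      cases t with
      | inl t =>
        rcases ih with ih | ⟨x', y', t', h3, h4, rfl⟩
        · exact Or.inl (.step h1 ih)
        · exact Or.inr ⟨x ++ x', y', t', .step h1 h3, h4, by simp⟩
      | inr t =>
        obtain ⟨rfl, hJ⟩ := h1
        exact Or.inr ⟨[], y, t, .fin hJ, ih, rfl⟩
    | inr s =>
      cases t with
      | inl t => exact h1.2.elim
      | inr t => exact .step h1 ih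

theorem gacc_inr {s : S₂} {w : List A} (h : GAcc D₂ F₂ s w) :
    GAcc (sumD D₁ D₂ J) (Sum.elim F₁ F₂) (.inr s) w := by
  induction h with
  | fin h => exact .fin h
  | @step s t x y h1 h2 ih => exact .step (t := Sum.inr t) h1 ih

theorem gacc_inl {s : S₁} {w : List A} (h : GAcc D₁ F₁ s w) :
    GAcc (sumD D₁ D₂ J) (Sum.elim F₁ F₂) (.inl s) w := by
  induction h with
  | fin h => exact .fin h
  | @step s t x y h1 h2 ih => exact .step (t := Sum.inl t) h1 ih

theorem gacc_inl' {s : S₁} {t : S₂} {x y : List A} (h : GAcc D₁ (fun s' => J s' t) s x)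
    (hy : GAcc D₂ F₂ t y) : GAcc (sumD D₁ D₂ J) (Sum.elim F₁ F₂) (.inl s) (x ++ y) := by
  induction h with
  | fin h => exact .step (t := Sum.inr t) ⟨rfl, h⟩ (gacc_inr D₁ D₂ J hy)
  | @step s t x y h1 h2 ih =>
    rw [List.append_assoc]
    exact .step (t := Sum.inl t) h1 ih

end sum

theorem gacc_and {S : Type} {D : S → S → Set (List A)} {F : S → Prop} {P : Prop} {s : S}
    {w : List A} : GAcc D (fun s => F s ∧ P) s w ↔ GAcc D F s w ∧ P := by
  constructor
  · intro h
    induction h with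
    | fin h => exact ⟨.fin h.1, h.2⟩
    | step h1 h2 ih => exact ⟨.step h1 ih.1, ih.2⟩
  · rintro ⟨h, hP⟩
    induction h with
    | fin h => exact .fin ⟨h, hP⟩
    | step h1 h2 ih => exact .step h1 ih

theorem gacc_false {S : Type} {D : S → S → Set (List A)} {F : S → Prop} (hF : ∀ s, ¬ F s) {s : S}
    {w : List A} : ¬ GAcc D F s w := by
  intro h
  induction h with
  | fin h => exact hF _ h
  | step h1 h2 ih => exact ih

theorem grec_union {L₁ L₂ : Set (List A)} (h₁ : GRec L₁) (h₂ : GRec L₂) : GRec (L₁ ∪ L₂) := by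
  obtain ⟨S₁, _, _, D₁, I₁, F₁, d₁, h₁⟩ := h₁
  obtain ⟨S₂, _, _, D₂, I₂, F₂, d₂, h₂⟩ := h₂
  refine ⟨S₁ ⊕ S₂, inferInstance, inferInstance, sumD D₁ D₂ (fun _ _ => False),
    Sum.elim I₁ I₂, Sum.elim F₁ F₂, dcfl_sumD _ _ _ d₁ d₂, ?_⟩
  intro w
  constructor
  · rintro (h | h)
    · obtain ⟨s, h, hs⟩ := (h₁ w).1 h
      exact ⟨.inl s, h, gacc_inl _ _ _ hs⟩
    · obtain ⟨s, h, hs⟩ := (h₂ w).1 h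
      exact ⟨.inr s, h, gacc_inr _ _ _ hs⟩
  · rintro ⟨s | s, h, hs⟩
    · rcases gacc_sum _ _ _ hs with hs | ⟨x, y, t, h, _⟩
      · exact Or.inl ((h₁ w).2 ⟨s, h, hs⟩)
      · exact (gacc_false (fun _ h => h) h).elim
    · exact Or.inr ((h₂ w).2 ⟨s, h, gacc_sum _ _ _ hs⟩)

theorem grec_concat {L₁ L₂ : Set (List A)} (h₁ : GRec L₁) (h₂ : GRec L₂) :
    GRec (concatL L₁ L₂) := by
  obtain ⟨S₁, _, _, D₁, I₁, F₁, d₁, h₁⟩ := h₁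
  obtain ⟨S₂, _, _, D₂, I₂, F₂, d₂, h₂⟩ := h₂
  refine ⟨S₁ ⊕ S₂, inferInstance, inferInstance, sumD D₁ D₂ (fun s t => F₁ s ∧ I₂ t),
    Sum.elim I₁ (fun _ => False), Sum.elim (fun _ => False) F₂, dcfl_sumD _ _ _ d₁ d₂, ?_⟩
  intro w
  constructor
  · rintro ⟨x, hx, y, hy, rfl⟩
    obtain ⟨s, h, hs⟩ := (h₁ x).1 hx
    obtain ⟨t, h', ht⟩ := (h₂ y).1 hy
    exact ⟨.inl s, h, gacc_inl' _ _ _ (gacc_and.2 ⟨hs, h'⟩) ht⟩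
  · rintro ⟨s | s, h, hs⟩
    · rcases gacc_sum _ _ _ hs with hs | ⟨x, y, t, h3, h4, rfl⟩
      · exact (gacc_false (fun _ h => h) hs).elim
      · obtain ⟨h3, h5⟩ := gacc_and.1 h3
        exact ⟨x, (h₁ x).2 ⟨s, h, h3⟩, y, (h₂ y).2 ⟨t, h5, h4⟩, rfl⟩
    · exact h.elim

def starD {S : Type} (D : S → S → Set (List A)) (I F : S → Prop) :
    Option S → Option S → Set (List A)
  | some s, some t => D s t
  | none, some t => epsIf (I t)
  | some s, none => epsIf (F s)
  | none, none => epsIf False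

theorem grec_star {L : Set (List A)} (h : GRec L) : GRec (kstarL L) := by
  obtain ⟨S, _, _, D, I, F, d, h⟩ := h
  refine ⟨Option S, inferInstance, inferInstance, starD D I F, fun o => o = none,
    fun o => o = none, ?_, ?_⟩
  · rintro (_ | s) (_ | t)
    · exact dcfl_epsIf _
    · exact dcfl_epsIf _
    · exact dcfl_epsIf _
    · exact d s t
  intro w
  constructor
  · rintro ⟨l, hl, rfl⟩
    refine ⟨none, rfl, ?_⟩
    have key : ∀ s x y, GAcc D F s x → GAcc (starD D I F) (fun o => o = none) none y →
        GAcc (starD D I F) (fun o => o = none) (some s) (x ++ y) := by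
      intro s x y hx hy
      induction hx with
      | fin h => exact .step (t := none) ⟨rfl, h⟩ hy
      | @step s t x y h1 h2 ih =>
        rw [List.append_assoc]
        exact .step (t := some t) h1 ih
    induction l with
    | nil => exact .fin rfl
    | cons u l ih =>
      obtain ⟨s, hs, hu⟩ := (h u).1 (hl u (by simp))
      exact .step (t := some s) (x := []) ⟨rfl, hs⟩
        (key s u _ hu (ih fun v hv => hl v (by simp [hv])))
  · rintro ⟨o, rfl, hw⟩
    have key : ∀ o w, GAcc (starD D I F) (fun o => o = none) o w →
        match o with
        | none => w ∈ kstarL L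
        | some s => ∃ x y, GAcc D F s x ∧ y ∈ kstarL L ∧ w = x ++ y := by
      intro o w hw
      induction hw with
      | @fin s h => subst h; exact ⟨[], by simp, rfl⟩
      | @step s t x y h1 h2 ih =>
        cases s with
        | none =>
          cases t with
          | none => exact h1.2.elim
          | some t =>
            obtain ⟨rfl, hI⟩ := h1
            obtain ⟨x, y, h3, ⟨l, hl, rfl⟩, rfl⟩ := ih
            refine ⟨x :: l, ?_, rfl⟩
            intro u hu
            rcases List.mem_cons.1 hu with rfl | hu
            · exact (h u).2 ⟨t, hI, h3⟩
            · exact hl u hu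
        | some s =>
          cases t with
          | none =>
            obtain ⟨rfl, hF⟩ := h1
            exact ⟨[], y, .fin hF, ih, rfl⟩
          | some t =>
            obtain ⟨x', y', h3, h4, rfl⟩ := ih
            exact ⟨x ++ x', y', .step h1 h3, h4, by simp⟩
    exact key none w hw

theorem grec_of_reg {L : Set (List A)} (h : RegClosureDCFL L) : GRec L := by
  induction h with
  | dcfl h => exact grec_dcfl h
  | union _ _ h₁ h₂ => exact grec_union h₁ h₂
  | concat _ _ h₁ h₂ => exact grec_concat h₁ h₂
  | star _ h => exact grec_star h

theorem gacc_decomp {S : Type} {D : S → S → Set (List A)} {F : S → Prop} {s : S} {w : List A} :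
    GAcc D F s w ↔ (w = [] ∧ GAcc D F s []) ∨ ∃ st : S × S,
      ReflTransGen (fun s t => [] ∈ D s t) s st.1 ∧ ∃ x y, x ≠ [] ∧ x ∈ D st.1 st.2 ∧
        GAcc D F st.2 y ∧ w = x ++ y := by
  constructor
  · intro h
    induction h with
    | fin h => exact Or.inl ⟨rfl, .fin h⟩
    | @step s t x y h1 h2 ih =>
      by_cases hx : x = []
      · subst hx
        rcases ih with ⟨rfl, h⟩ | ⟨st, h3, h4⟩
        · exact Or.inl ⟨rfl, .step h1 h2⟩
        · exact Or.inr ⟨st, .head h1 h3, h4⟩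
      · exact Or.inr ⟨(s, t), .refl, x, y, hx, h1, h2, rfl⟩
  · rintro (⟨rfl, h⟩ | ⟨⟨s', t⟩, h, x, y, _, h1, h2, rfl⟩)
    · exact h
    · simp only at h h1 h2
      induction h using ReflTransGen.head_induction_on with
      | refl => exact .step h1 h2
      | head h _ ih => exact .step (x := []) h ih

/-! ### PEG-decidable languages -/

def Decided (L : Set (List A)) : Prop :=
  ∃ (N : Type) (_ : Finite N) (G : PEG N A) (rank : N → ℕ),
    (∀ X, ∀ Y ∈ (G.rule X).leftNts, rank Y < rank X) ∧ ∃ e : PExp N A,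
      ∀ w, (w ∈ L → ∃ s, Parses G e w (some s)) ∧ (w ∉ L → Parses G e w none)

section base
variable {S : Type} {Q Γ : S × S → Type}

abbrev NT (Q Γ : S × S → Type) : Type :=
  S ⊕ (Σ st : S × S, (Q st × Γ st × Q st) ⊕ (Q st × Γ st))

def popN (st : S × S) (q : Q st) (Z : Γ st) (p : Q st) : NT Q Γ := .inr ⟨st, .inl (q, Z, p)⟩
def accN (st : S × S) (q : Q st) (Z : Γ st) : NT Q Γ := .inr ⟨st, .inr (q, Z)⟩

variable [Finite A] [Finite S] [∀ st, Finite (Q st)] (M : ∀ st, DPDA (Q st) A (Γ st))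
  (D : S → S → Set (List A)) (F : S → Prop)

open Classical in
noncomputable def xRule (s : S) : PExp (NT Q Γ) A :=
  .choice (if GAcc D F s [] then .not (finC fun a => .term a) else failE)
    (finC fun st : S × S => if ReflTransGen (fun s t => [] ∈ D s t) s st.1 then
      startExp (M st) (popN st) (accN st) (.inl st.2) (M st).init (M st).Z0 else failE)

noncomputable def ruleN : NT Q Γ → PExp (NT Q Γ) A
  | .inl s => xRule M D F s
  | .inr ⟨st, .inl (q, Z, p)⟩ => popRule (M st) (popN st) q Z p
  | .inr ⟨st, .inr (q, Z)⟩ => accRule (M st) (popN st) (accN st) (.inl st.2) q Z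

noncomputable def pegN (s₀ : S) : PEG (NT Q Γ) A := ⟨ruleN M D F, .inl s₀⟩

theorem leftNts_xRule (s : S) : (xRule M D F s).leftNts = ∅ := by
  rw [← Set.subset_empty_iff]
  refine Set.union_subset ?_ (leftNts_finC fun st => ?_)
  · split_ifs
    · exact leftNts_finC fun a => by simp [PExp.leftNts]
    · simp [leftNts_fail]
  · split_ifs
    · rw [leftNts_startExp]
    · simp [leftNts_fail]

theorem rank_pegN (s₀ : S) (X Y : NT Q Γ) (hY : Y ∈ ((pegN M D F s₀).rule X).leftNts) :
    Sum.elim (fun _ => 0) (fun _ => 1) Y < (Sum.elim (fun _ => 0) (fun _ => 1) X : ℕ) := by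
  rcases X with s | ⟨st, ⟨q, Z, p⟩ | ⟨q, Z⟩⟩
  · simp [pegN, ruleN, leftNts_xRule] at hY
  · simp [pegN, ruleN, leftNts_popRule] at hY
  · have := leftNts_accRule _ _ _ _ _ _ hY
    simp only [Set.mem_singleton_iff] at this
    subst this
    simp

open Classical in
theorem dec_pegN (hD : ∀ s t, (M (s, t)).Lang = D s t) (s₀ : S) (n : ℕ) :
    ∀ s w, w.length < n → Dec (pegN M D F s₀) (.nt (.inl s)) w
      (fun w' => w' = [] ∧ GAcc D F s w) := by
  induction n with
  | zero => intro s w h; omega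
  | succ n ih =>
    intro s w hw
    apply dec_nt
    change Dec _ (xRule M D F s) w _
    have h1 : Dec (pegN M D F s₀)
        (if GAcc D F s [] then .not (finC fun a => .term a) else failE) w
        (fun w' => w' = [] ∧ w = [] ∧ GAcc D F s []) := by
      split_ifs with hc
      · refine (dec_not (dec_finC (fun a => dec_term _ a w) ?_)).congr ?_
        · rintro x y ⟨a, rfl⟩ ⟨b, h⟩
          cases h; rfl
        · intro w'
          cases w with
          | nil => simp [hc]
          | cons a u =>
            simp only [reduceCtorEq, false_and, and_false, iff_false]
            rintro ⟨_, h⟩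
            exact h u ⟨a, rfl⟩
      · exact dec_fail _ _ (by simp [hc])
    have h2 : ∀ st : S × S, Dec (pegN M D F s₀)
        (if ReflTransGen (fun s t => [] ∈ D s t) s st.1 then
          startExp (M st) (popN st) (accN st) (.inl st.2) (M st).init (M st).Z0 else failE) w
        (fun w' => w' = [] ∧ ReflTransGen (fun s t => [] ∈ D s t) s st.1 ∧
          ∃ x y, x ≠ [] ∧ x ∈ D st.1 st.2 ∧ GAcc D F st.2 y ∧ w = x ++ y) := by
      intro st
      split_ifs with hc
      · refine (dec_start' (M st) (popN st) (accN st) (.inl st.2) (Yl := GAcc D F st.2)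
          (fun _ _ => rfl) (fun _ _ _ => rfl) n (fun w hw => ih st.2 w hw) w hw).congr ?_
        intro w'
        have : (M st).Lang = D st.1 st.2 := hD st.1 st.2
        rw [this]
        simp [hc]
      · exact dec_fail _ _ (by simp [hc])
    refine (dec_choice h1 (dec_finC h2 ?_) ?_).congr ?_
    · rintro x y ⟨_, rfl, _⟩ ⟨_, rfl, _⟩; rfl
    · rintro x y (⟨rfl, _⟩ | ⟨_, rfl, _⟩) (⟨rfl, _⟩ | ⟨_, rfl, _⟩) <;> rfl
    · intro w'
      rw [gacc_decomp (w := w), and_or_left, exists_and_left]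

end base

theorem decided_of_grec [Finite A] {L : Set (List A)} (h : GRec L) : Decided L := by
  classical
  obtain ⟨S, _, ⟨s₀⟩, D, I, F, d, h⟩ := h
  choose Q Γ hQ hΓ M hM using d
  let Q' : S × S → Type := fun st => Q st.1 st.2
  let Γ' : S × S → Type := fun st => Γ st.1 st.2
  have : ∀ st, Finite (Q' st) := fun st => hQ _ _
  have : ∀ st, Finite (Γ' st) := fun st => hΓ _ _
  let M' : ∀ st, DPDA (Q' st) A (Γ' st) := fun st => M st.1 st.2
  refine ⟨NT Q' Γ', inferInstance, pegN M' D F s₀, Sum.elim (fun _ => 0) (fun _ => 1),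
    rank_pegN M' D F s₀, finC fun s : S => if I s then .nt (.inl s) else failE, fun w => ?_⟩
  have key : Dec (pegN M' D F s₀) (finC fun s : S => if I s then .nt (.inl s) else failE) w
      (fun w' => ∃ s, w' = [] ∧ I s ∧ GAcc D F s w) := by
    refine dec_finC (fun s => ?_) ?_
    · split_ifs with hI
      · exact (dec_pegN M' D F (fun s t => hM s t) s₀ (w.length + 1) s w (by omega)).congr
          (by simp [hI])
      · exact dec_fail _ _ (by simp [hI])
    · rintro x y ⟨_, rfl, _⟩ ⟨_, rfl, _⟩; rfl
  constructor
  · intro hw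
    obtain ⟨s, hs⟩ := (h w).1 hw
    exact ⟨[], key.1 [] ⟨s, rfl, hs⟩⟩
  · intro hw
    refine key.2 ?_
    rintro w' ⟨s, _, hs⟩
    exact hw ((h w).2 ⟨s, hs⟩)

/-! ### Renaming nonterminals and Boolean operations -/

def mapE {N' : Type} (f : N → N') : PExp N A → PExp N' A
  | .eps => .eps
  | .term a => .term a
  | .nt B => .nt (f B)
  | .seq e₁ e₂ => .seq (mapE f e₁) (mapE f e₂)
  | .choice e₁ e₂ => .choice (mapE f e₁) (mapE f e₂)
  | .not e => .not (mapE f e)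

theorem parses_map {N' : Type} {f : N → N'} {G : PEG N A} {G' : PEG N' A}
    (hG : ∀ B, G'.rule (f B) = mapE f (G.rule B)) {e : PExp N A} {w : List A}
    {r : Option (List A)} (h : Parses G e w r) : Parses G' (mapE f e) w r := by
  induction h with
  | eps w => exact .eps w
  | term_ok a s => exact .term_ok a s
  | term_mismatch s h => exact .term_mismatch s h
  | term_nil a => exact .term_nil a
  | nt _ ih => exact .nt (by rw [hG]; exact ih)
  | seq_ok _ _ h1 h2 => exact .seq_ok h1 h2
  | seq_fail _ h1 => exact .seq_fail h1
  | choice_fst _ h1 => exact .choice_fst h1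
  | choice_snd _ _ h1 h2 => exact .choice_snd h1 h2
  | not_succ _ h1 => exact .not_succ h1
  | not_fail _ h1 => exact .not_fail h1

theorem maybeEmpty_map {N' : Type} (f : N → N') (e : PExp N A) :
    (mapE f e).maybeEmpty = e.maybeEmpty := by
  induction e <;> simp_all [mapE, PExp.maybeEmpty]

theorem leftNts_map {N' : Type} (f : N → N') (e : PExp N A) :
    (mapE f e).leftNts = f '' e.leftNts := by
  induction e with
  | seq e₁ e₂ h₁ h₂ =>
    simp only [mapE, PExp.leftNts, maybeEmpty_map, h₁, h₂, Set.image_union]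
    split_ifs <;> simp
  | choice e₁ e₂ h₁ h₂ => simp [mapE, PExp.leftNts, h₁, h₂, Set.image_union]
  | not e h => simpa [mapE, PExp.leftNts] using h
  | _ => simp [mapE, PExp.leftNts]

theorem parses_det {G : PEG N A} {e : PExp N A} {w : List A} {r r' : Option (List A)}
    (h : Parses G e w r) (h' : Parses G e w r') : r = r' := by
  induction h generalizing r' with
  | eps w => cases h'; rfl
  | term_ok a s =>
    cases h' with
    | term_ok => rfl
    | term_mismatch _ h => exact (h rfl).elim
  | term_mismatch s h =>
    cases h' with
    | term_ok => exact (h rfl).elim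
    | term_mismatch => rfl
  | term_nil a => cases h'; rfl
  | nt _ ih => cases h' with | nt h => exact ih h
  | seq_ok _ _ h1 h2 =>
    cases h' with
    | seq_ok a b => cases h1 a; exact h2 b
    | seq_fail a => cases h1 a
  | seq_fail _ h1 =>
    cases h' with
    | seq_ok a b => cases h1 a
    | seq_fail a => rfl
  | choice_fst _ h1 =>
    cases h' with
    | choice_fst a => exact h1 a
    | choice_snd a b => cases h1 a
  | choice_snd _ _ h1 h2 =>
    cases h' with
    | choice_fst a => cases h1 a
    | choice_snd a b => exact h2 b
  | not_succ _ h1 =>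
    cases h' with
    | not_succ a => rfl
    | not_fail a => cases h1 a
  | not_fail _ h1 =>
    cases h' with
    | not_succ a => cases h1 a
    | not_fail a => rfl

theorem decided_compl {L : Set (List A)} (h : Decided L) : Decided Lᶜ := by
  obtain ⟨N, hN, G, rank, hr, e, he⟩ := h
  refine ⟨N, hN, G, rank, hr, .not e, fun w => ⟨fun hw => ?_, fun hw => ?_⟩⟩
  · exact ⟨w, .not_succ ((he w).2 hw)⟩
  · obtain ⟨s, hs⟩ := (he w).1 (not_not.1 hw)
    exact .not_fail hs

theorem decided_union {L₁ L₂ : Set (List A)} (h₁ : Decided L₁) (h₂ : Decided L₂) :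
    Decided (L₁ ∪ L₂) := by
  obtain ⟨N₁, _, G₁, rank₁, hr₁, e₁, he₁⟩ := h₁
  obtain ⟨N₂, _, G₂, rank₂, hr₂, e₂, he₂⟩ := h₂
  let G : PEG (N₁ ⊕ N₂) A :=
    ⟨Sum.elim (fun n => mapE Sum.inl (G₁.rule n)) (fun n => mapE Sum.inr (G₂.rule n)),
      .inl G₁.start⟩
  have m₁ : ∀ {e w r}, Parses G₁ e w r → Parses G (mapE Sum.inl e) w r :=
    fun h => parses_map (fun _ => rfl) h
  have m₂ : ∀ {e w r}, Parses G₂ e w r → Parses G (mapE Sum.inr e) w r :=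
    fun h => parses_map (fun _ => rfl) h
  refine ⟨N₁ ⊕ N₂, inferInstance, G, Sum.elim rank₁ rank₂, ?_,
    .choice (mapE Sum.inl e₁) (mapE Sum.inr e₂), fun w => ⟨fun hw => ?_, fun hw => ?_⟩⟩
  · rintro (X | X) Y hY
    · change Y ∈ (mapE Sum.inl (G₁.rule X)).leftNts at hY
      rw [leftNts_map] at hY
      obtain ⟨Y, hY, rfl⟩ := hY
      exact hr₁ X Y hY
    · change Y ∈ (mapE Sum.inr (G₂.rule X)).leftNts at hY
      rw [leftNts_map] at hY
      obtain ⟨Y, hY, rfl⟩ := hY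
      exact hr₂ X Y hY
  · by_cases h1 : w ∈ L₁
    · obtain ⟨s, hs⟩ := (he₁ w).1 h1
      exact ⟨s, .choice_fst (m₁ hs)⟩
    · obtain ⟨s, hs⟩ := (he₂ w).1 (hw.resolve_left h1)
      exact ⟨s, .choice_snd (m₁ ((he₁ w).2 h1)) (m₂ hs)⟩
  · exact .choice_snd (m₁ ((he₁ w).2 fun h => hw (Or.inl h)))
      (m₂ ((he₂ w).2 fun h => hw (Or.inr h)))

theorem decided_of_bool [Finite A] {L : Set (List A)}
    (h : BoolClosure (fun L' => RegClosureDCFL L') L) : Decided L := by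
  induction h with
  | base h => exact decided_of_grec (grec_of_reg h)
  | union _ _ h₁ h₂ => exact decided_union h₁ h₂
  | @inter L₁ L₂ _ _ h₁ h₂ =>
    have : L₁ ∩ L₂ = (L₁ᶜ ∪ L₂ᶜ)ᶜ := by simp
    rw [this]
    exact decided_compl (decided_union (decided_compl h₁) (decided_compl h₂))
  | compl _ h => exact decided_compl h

theorem pel_of_decided [Finite A] {L : Set (List A)} (h : Decided L) : IsPEL L := by
  obtain ⟨N, _, G, rank, hr, e, he⟩ := h
  let G' : PEG (N ⊕ Bool) A :=
    ⟨Sum.elim (fun n => mapE Sum.inl (G.rule n)) (fun b => if b then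
        .seq (.not (.not (mapE Sum.inl e))) (.nt (.inr false))
      else .choice (finC fun a => .seq (.term a) (.nt (.inr false))) .eps), .inr true⟩
  have m : ∀ {e w r}, Parses G e w r → Parses G' (mapE Sum.inl e) w r :=
    fun h => parses_map (fun _ => rfl) h
  have hany : ∀ w, Dec G' (.nt (.inr false)) w (fun w' => w' = []) := by
    intro w
    induction w with
    | nil =>
      refine dec_nt ((dec_choice (dec_finC (fun a => dec_seq (R₂ := fun _ _ => False)
        (dec_term _ a []) (by simp)) ?_) (dec_eps _ _) ?_).congr ?_)
      · simp [Func]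
      · simp [Func]
      · simp
    | cons b u ih =>
      constructor
      · rintro w' rfl
        refine .nt (.choice_fst ?_)
        refine (dec_finC (R := fun a w' => ∃ v, b :: u = a :: v ∧ w' = [])
          (fun a => dec_seq (dec_term _ a (b :: u)) ?_) ?_).1 [] ⟨b, u, rfl, rfl⟩
        · intro v hv
          cases hv
          exact ih
        · rintro x y ⟨_, _, _, rfl⟩ ⟨_, _, _, rfl⟩; rfl
      · intro h
        exact (h [] rfl).elim
  refine ⟨N ⊕ Bool, inferInstance, G', ?_, ?_⟩
  · obtain ⟨B, hB⟩ := (Set.finite_range rank).bddAbove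
    have hB' : ∀ n, rank n ≤ B := fun n => hB ⟨n, rfl⟩
    let rk : N ⊕ Bool → ℕ := Sum.elim rank (fun b => if b then B + 1 else 0)
    have hrk : ∀ X Y, Y ∈ (G'.rule X).leftNts → rk Y < rk X := by
      rintro (X | _ | _) Y hY
      · change Y ∈ (mapE Sum.inl (G.rule X)).leftNts at hY
        rw [leftNts_map] at hY
        obtain ⟨Y, hY, rfl⟩ := hY
        exact hr X Y hY
      · have : (PExp.choice (finC fun a : A => .seq (.term a) (.nt (.inr false : N ⊕ Bool)))
            .eps).leftNts ⊆ ∅ :=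
          Set.union_subset (leftNts_finC fun a => by simp [PExp.leftNts, PExp.maybeEmpty])
            (by simp [PExp.leftNts])
        exact (this hY).elim
      · change Y ∈ (PExp.seq (.not (.not (mapE Sum.inl e)))
          (.nt (.inr false : N ⊕ Bool))).leftNts at hY
        simp only [PExp.leftNts, leftNts_map, PExp.maybeEmpty, if_true] at hY
        rcases hY with ⟨Y, _, rfl⟩ | hY
        · have := hB' Y
          simp only [rk, Sum.elim_inl, Sum.elim_inr, if_true]
          omega
        · cases hY
          simp [rk]
    intro X hX
    have : ∀ Y, TransGen (fun X Y => Y ∈ (G'.rule X).leftNts) X Y → rk Y < rk X := by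
      intro Y h
      induction h with
      | single h => exact hrk _ _ h
      | tail _ h ih => exact (hrk _ _ h).trans ih
    exact lt_irrefl _ (this X hX)
  · ext w
    constructor
    · intro h
      by_contra hw
      have : Parses G' (.nt (.inr true)) w none :=
        .nt (.seq_fail (.not_fail (.not_succ (m ((he w).2 hw)))))
      cases parses_det h this
    · intro hw
      obtain ⟨s, hs⟩ := (he w).1 hw
      exact .nt (.seq_ok (.not_succ (.not_fail (m hs))) ((hany w).1 [] rfl))

end PELProof

/-- The Boolean closure of the regular closure of the DCFLs is
contained in the class of parsing expression languages:
`Γ_Bool(Γ_REG(DCFL)) ⊆ PEL`. -/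
theorem boolClosure_regClosure_dcfl_subset_pel {A : Type} [Finite A]
    (L : Set (List A)) (hL : BoolClosure (fun L' => RegClosureDCFL L') L) :
    IsPEL L := by
  exact PELProof.pel_of_decided (PELProof.decided_of_bool hL)
end
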